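/- arXiv:2102.02419 — 5 statements merged into one kernel-verified Lean document; each statement's English description precedes it below -/
import Mathlib

section
/- Let λ > 1 be irrational, let f ∈ G_λ with f ≠ id, and let c ∈ {1, λ}. Then there exists an element g of the normal closure of f in G_λ such that: (1) x·g = x for all x ∈ c·ℤ; and (2) there exist x, y ∈ [0, c] with x < y such that (x + c·n)·g > y + c·n for every n ∈ ℤ. -/
open Set

noncomputable section

/-- The dyadic rationals `ℤ[1/2]` inside `ℝ`. -/
def DyadicRat : Set ℝ := {x : ℝ | ∃ (a : ℤ) (k : ℕ), x = a / 2 ^ k}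

/-- A function `g : ℝ → ℝ` satisfies the defining conditions of (the underlying map of)
an element of `T̄`: it commutes with the translation `x ↦ x + 1`, and away from a
locally finite set `D ⊆ ℤ[1/2]` of allowed breakpoints it is locally affine with slope
an integer power of `2`.  (Local finiteness of `D` on compact intervals encodes
"finitely many breakpoints in each compact interval".) -/
def TbarFun (g : ℝ → ℝ) : Prop :=
  (∀ x : ℝ, g (x + 1) = g x + 1) ∧
  ∃ D : Set ℝ, D ⊆ DyadicRat ∧ (∀ a b : ℝ, (D ∩ Set.Icc a b).Finite) ∧
    ∀ x : ℝ, x ∉ D → ∃ (m : ℤ) (c ε : ℝ), 0 < ε ∧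
      ∀ y : ℝ, |y - x| < ε → g y = 2 ^ m * y + c

/-- The lift `T̄` of Thompson's group `T` to the real line, as a set of increasing
bijections of `ℝ`. -/
def Tbar : Set (Equiv.Perm ℝ) := {g : Equiv.Perm ℝ | StrictMono ⇑g ∧ TbarFun ⇑g}

/-- `T̄_λ = m_λ⁻¹ T̄ m_λ`, where `x · m_λ = λ x`: the lift of `T` with respect to the
identification `ℝ → ℝ/λℤ`. -/
def TbarL (l : ℝ) : Set (Equiv.Perm ℝ) :=
  {g : Equiv.Perm ℝ | StrictMono ⇑g ∧ TbarFun (fun y : ℝ => g (l * y) / l)}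

/-- The group `G_λ = ⟨T̄ ∪ T̄_λ⟩ ≤ Homeo⁺(ℝ)`. -/
def Glambda (l : ℝ) : Subgroup (Equiv.Perm ℝ) := Subgroup.closure (Tbar ∪ TbarL l)

theorem DyadicRat.add {a b : ℝ} (ha : a ∈ DyadicRat) (hb : b ∈ DyadicRat) : a + b ∈ DyadicRat := by
  obtain ⟨m, k, rfl⟩ := ha
  obtain ⟨n, j, rfl⟩ := hb
  refine ⟨m * 2 ^ j + n * 2 ^ k, k + j, ?_⟩
  push_cast
  rw [pow_add]
  field_simp

theorem DyadicRat.neg {a : ℝ} (ha : a ∈ DyadicRat) : -a ∈ DyadicRat := by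
  obtain ⟨m, k, rfl⟩ := ha
  exact ⟨-m, k, by push_cast; ring⟩

theorem DyadicRat.div_two {a : ℝ} (ha : a ∈ DyadicRat) : a / 2 ∈ DyadicRat := by
  obtain ⟨m, k, rfl⟩ := ha
  exact ⟨m, k + 1, by rw [pow_succ]; field_simp⟩

theorem DyadicRat.intCast (n : ℤ) : (n : ℝ) ∈ DyadicRat := ⟨n, 0, by simp⟩

theorem DyadicRat.exists_between {a b : ℝ} (h : a < b) : ∃ w ∈ DyadicRat, a < w ∧ w < b := by
  obtain ⟨k, hk⟩ := exists_pow_lt_of_lt_one (sub_pos.2 h) (by norm_num : (1 / 2 : ℝ) < 1)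
  have h2 : (0 : ℝ) < 2 ^ k := by positivity
  refine ⟨(⌊a * 2 ^ k⌋ + 1 : ℤ) / 2 ^ k, ⟨_, k, rfl⟩, ?_, ?_⟩
  · rw [lt_div_iff₀ h2]
    push_cast
    exact Int.lt_floor_add_one _
  · rw [div_lt_iff₀ h2]
    push_cast
    have h3 := Int.floor_le (a * 2 ^ k)
    rw [one_div, inv_pow, inv_lt_iff_one_lt_mul₀ h2] at hk
    linarith

/-- A tent-like profile supported on `[0, D]`, with slopes `1`, `0`, `-1/2`. -/
def bumpProfile (D r : ℝ) : ℝ := max 0 (min r (min (D / 4) ((D - r) / 2)))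

/-- The `1`-periodic map `x ↦ x + bumpProfile D (fract (x - w))`. -/
def bump (w D x : ℝ) : ℝ := x + bumpProfile D (Int.fract (x - w))

theorem bump_eq {w D x r : ℝ} {n : ℤ} (h : x = w + n + r) (h0 : 0 ≤ r) (h1 : r < 1) :
    bump w D x = x + bumpProfile D r := by
  have : Int.fract (x - w) = r := by
    rw [Int.fract_eq_iff]
    exact ⟨h0, h1, n, by rw [h]; ring⟩
  rw [bump, this]

theorem bump_add_int (w D x : ℝ) (m : ℤ) : bump w D (x + m) = bump w D x + m := by
  have : x + m - w = x - w + m := by ring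
  rw [bump, bump, this, Int.fract_add_intCast]
  ring

theorem bump_decomp (w x : ℝ) : ∃ (n : ℤ) (r : ℝ), x = w + n + r ∧ 0 ≤ r ∧ r < 1 :=
  ⟨⌊x - w⌋, Int.fract (x - w), by have := Int.floor_add_fract (x - w); linarith,
    Int.fract_nonneg _, Int.fract_lt_one _⟩

theorem add_bumpProfile_lt {D r s : ℝ} (h : r < s) :
    r + bumpProfile D r < s + bumpProfile D s := by
  unfold bumpProfile
  grind

theorem bump_strictMono {w D : ℝ} (hD : D ≤ 1) : StrictMono (bump w D) := by
  intro x y hxy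
  obtain ⟨n, r, hx, hr0, hr1⟩ := bump_decomp w x
  obtain ⟨m, s, hy, hs0, hs1⟩ := bump_decomp w y
  rw [bump_eq hx hr0 hr1, bump_eq hy hs0 hs1, hx, hy]
  have hnm : n ≤ m := by
    by_contra! hlt
    have : (m : ℝ) + 1 ≤ n := by exact_mod_cast hlt
    linarith
  rcases hnm.eq_or_lt with rfl | hlt
  · have := add_bumpProfile_lt (D := D) (r := r) (s := s) (by linarith)
    linarith
  · have h1 : (n : ℝ) + 1 ≤ m := by exact_mod_cast hlt
    have h2 : r + bumpProfile D r < 1 := by unfold bumpProfile; grind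
    have h3 : 0 ≤ bumpProfile D s := le_max_left _ _
    linarith

theorem bump_surjective {w D : ℝ} (hD0 : 0 ≤ D) : Function.Surjective (bump w D) := by
  intro y
  obtain ⟨n, r, rfl, hr0, hr1⟩ := bump_decomp w y
  have key : ∃ s, 0 ≤ s ∧ s < 1 ∧ s + bumpProfile D s = r := by
    unfold bumpProfile
    refine ⟨min r (max (r / 2) (max (r - D / 4) (2 * r - D))), ?_, ?_, ?_⟩ <;> grind
  obtain ⟨s, hs0, hs1, hs⟩ := key
  refine ⟨w + n + s, ?_⟩
  rw [bump_eq rfl hs0 hs1]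
  linarith

theorem finite_breakpoints (w : ℝ) (J : Finset ℝ) (a b : ℝ) :
    ({x : ℝ | ∃ k : ℤ, ∃ j ∈ J, x = w + k + j} ∩ Icc a b).Finite := by
  have : {x : ℝ | ∃ k : ℤ, ∃ j ∈ J, x = w + k + j} ∩ Icc a b ⊆
      ⋃ j ∈ J, (fun k : ℤ => w + k + j) '' Icc ⌊a - w - j⌋ ⌈b - w - j⌉ := by
    rintro _ ⟨⟨k, j, hj, rfl⟩, ha, hb⟩
    simp only [mem_iUnion]
    refine ⟨j, hj, k, ⟨?_, ?_⟩, rfl⟩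
    · have h1 := Int.floor_le (a - w - j)
      exact_mod_cast (by linarith : (⌊a - w - j⌋ : ℝ) ≤ k)
    · have h1 := Int.le_ceil (b - w - j)
      exact_mod_cast (by linarith : (k : ℝ) ≤ ⌈b - w - j⌉)
  refine Finite.subset ?_ this
  exact Finite.biUnion J.finite_toSet fun j _ => (finite_Icc _ _).image _

theorem tbarFun_bump {w D : ℝ} (hw : w ∈ DyadicRat) (hD : D ∈ DyadicRat) (hD0 : 0 < D) :
    TbarFun (bump w D) := by
  refine ⟨fun x => by simpa using bump_add_int w D x 1,
    {x : ℝ | ∃ k : ℤ, ∃ j ∈ ({0, D / 4, D / 2, D} : Finset ℝ), x = w + k + j}, ?_,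
    finite_breakpoints w _, ?_⟩
  · rintro _ ⟨k, j, hj, rfl⟩
    refine DyadicRat.add (DyadicRat.add hw (DyadicRat.intCast k)) ?_
    simp only [Finset.mem_insert, Finset.mem_singleton] at hj
    rcases hj with rfl | rfl | rfl | rfl
    · simpa using DyadicRat.intCast 0
    · have := DyadicRat.div_two (DyadicRat.div_two hD)
      rwa [div_div, show (2 : ℝ) * 2 = 4 by norm_num] at this
    · exact DyadicRat.div_two hD
    · exact hD
  · intro x hx
    obtain ⟨n, r, hxr, hr0, hr1⟩ := bump_decomp w x
    have hne : ∀ j ∈ ({0, D / 4, D / 2, D} : Finset ℝ), r ≠ j := fun j hj hrj =>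
      hx ⟨n, j, hj, by rw [hxr, hrj]⟩
    have ne0 := hne 0 (by simp)
    have ne1 := hne (D / 4) (by simp)
    have ne2 := hne (D / 2) (by simp)
    have ne3 := hne D (by simp)
    have hr0' : 0 < r := lt_of_le_of_ne hr0 ne0.symm
    /- It suffices to know the profile on a neighbourhood `(s, t)` of `r` inside `(0, 1)`. -/
    have key : ∀ (s t : ℝ) (m : ℤ) (c : ℝ), 0 ≤ s → t ≤ 1 → s < r → r < t →
        (∀ q, s < q → q < t → q + bumpProfile D q = 2 ^ m * q + c) →
        ∃ (m : ℤ) (c ε : ℝ), 0 < ε ∧ ∀ y : ℝ, |y - x| < ε → bump w D y = 2 ^ m * y + c := by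
      intro s t m c hs ht hsr hrt h
      refine ⟨m, w + n - 2 ^ m * (w + n) + c, min (r - s) (t - r),
        lt_min (by linarith) (by linarith), fun y hy => ?_⟩
      rw [abs_lt] at hy
      have h1 := min_le_left (r - s) (t - r)
      have h2 := min_le_right (r - s) (t - r)
      have hq1 : s < y - w - n := by linarith
      have hq2 : y - w - n < t := by linarith
      have hy' : y = w + n + (y - w - n) := by ring
      rw [bump_eq hy' (by linarith) (by linarith)]
      have := h _ hq1 hq2
      linear_combination this
    rcases lt_or_gt_of_ne ne1 with h1 | h1
    · exact key 0 (min (D / 4) 1) 1 0 le_rfl (min_le_right _ _) hr0' (lt_min h1 hr1)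
        fun q _ _ => by norm_num [bumpProfile]; grind
    rcases lt_or_gt_of_ne ne2 with h2 | h2
    · exact key (D / 4) (min (D / 2) 1) 0 (D / 4) (by linarith) (min_le_right _ _) h1
        (lt_min h2 hr1) fun q _ _ => by norm_num [bumpProfile]; grind
    rcases lt_or_gt_of_ne ne3 with h3 | h3
    · exact key (D / 2) (min D 1) (-1) (D / 2) (by linarith) (min_le_right _ _) h2
        (lt_min h3 hr1) fun q _ _ => by norm_num [bumpProfile]; grind
    · exact key D 1 0 0 hD0.le le_rfl h3 hr1 fun q _ _ => by norm_num [bumpProfile]; grind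

theorem mem_Glambda_of_tbarFun {l c : ℝ} (hc : c = 1 ∨ c = l) {g : Equiv.Perm ℝ}
    (hmono : StrictMono g) (hg : TbarFun fun y => g (c * y) / c) : g ∈ Glambda l := by
  refine Subgroup.subset_closure ?_
  rcases hc with rfl | rfl
  · exact Or.inl ⟨hmono, by simpa using hg⟩
  · exact Or.inr ⟨hmono, hg⟩

theorem addRight_mem_Glambda {l c : ℝ} (hc : c = 1 ∨ c = l) (hc0 : 0 < c) (a : ℝ) :
    Equiv.addRight (c * a) ∈ Glambda l := by
  refine mem_Glambda_of_tbarFun hc (fun x y h => by simpa using h) ?_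
  have key : (fun y => Equiv.addRight (c * a) (c * y) / c) = fun y => y + a := by
    funext y
    rw [Equiv.coe_addRight]
    field_simp
  rw [key]
  exact ⟨fun x => by ring, ∅, empty_subset _, by simp,
    fun x _ => ⟨0, a, 1, one_pos, fun y _ => by simp⟩⟩

/-- `G` contains, for all points `a`, `b` in an interval `(u, v)` of length at most `c`, an element
commuting with translation by `c`, supported in `(u, v) + cℤ`, and pushing `a` above `b`. -/
def HasPushes (G : Subgroup (Equiv.Perm ℝ)) (c : ℝ) : Prop :=
  ∀ u v a b : ℝ, u < a → a < v → u < b → b < v → v ≤ u + c →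
    ∃ h ∈ G, (∀ (x : ℝ) (m : ℤ), h (x + c * m) = h x + c * m) ∧
      (∀ x : ℝ, (∀ m : ℤ, ¬(u < x - c * m ∧ x - c * m < v)) → h x = x) ∧ b < h a

theorem exists_pow_apply_gt (h : Equiv.Perm ℝ) {a b κ : ℝ} (hκ : 0 < κ)
    (H : ∀ x, a ≤ x → x ≤ b → x + κ ≤ h x) : ∃ n : ℕ, b < (h ^ n) a := by
  by_contra! hle
  have key : ∀ n : ℕ, a + n * κ ≤ (h ^ n) a := by
    intro n
    induction n with
    | zero => simp
    | succ n ih =>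
      rw [pow_succ', Equiv.Perm.mul_apply]
      have h1 : 0 ≤ n * κ := by positivity
      have := H _ (by linarith) (hle n)
      rw [Nat.cast_succ]
      linarith
  obtain ⟨n, hn⟩ := exists_nat_gt ((b - a) / κ)
  rw [div_lt_iff₀ hκ] at hn
  linarith [key n, hle n]

theorem hasPushes_Glambda {l c : ℝ} (hc : c = 1 ∨ c = l) (hc0 : 0 < c) :
    HasPushes (Glambda l) c := by
  intro u v a b hua hav hub hbv hvu
  obtain ⟨w, hw, hw1, hw2⟩ := DyadicRat.exists_between
    (div_lt_div_of_pos_right (lt_min hua hub) hc0)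
  obtain ⟨w', hw', hw1', hw2'⟩ := DyadicRat.exists_between
    (div_lt_div_of_pos_right (max_lt hav hbv) hc0)
  rw [div_lt_iff₀ hc0] at hw1 hw1'
  rw [lt_div_iff₀ hc0] at hw2 hw2'
  obtain ⟨hwa, hwb⟩ := lt_min_iff.1 hw2
  obtain ⟨haw, hbw⟩ := max_lt_iff.1 hw1'
  obtain ⟨D, rfl⟩ : ∃ D, w' = w + D := ⟨w' - w, by ring⟩
  have hD : D ∈ DyadicRat := by
    simpa using DyadicRat.add hw' (DyadicRat.neg hw)
  have hD0 : 0 < D := by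
    have : w * c < (w + D) * c := hwa.trans haw
    have := lt_of_mul_lt_mul_right this hc0.le
    linarith
  have hD1 : D ≤ 1 := by
    have : D * c < 1 * c := by linarith
    exact (lt_of_mul_lt_mul_right this hc0.le).le
  have hmono := bump_strictMono (w := w) hD1
  let ψ : Equiv.Perm ℝ := Equiv.ofBijective _ ⟨hmono.injective, bump_surjective hD0.le⟩
  let s : Equiv.Perm ℝ := Equiv.mulRight₀ c hc0.ne'
  let h₀ : Equiv.Perm ℝ := s * ψ * s⁻¹
  have h₀_apply : ∀ x, h₀ x = bump w D (x / c) * c := fun x => rfl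
  have h₀_mem : h₀ ∈ Glambda l := by
    refine mem_Glambda_of_tbarFun hc (fun x y hxy => ?_) ?_
    · rw [h₀_apply, h₀_apply]
      exact mul_lt_mul_of_pos_right (hmono (div_lt_div_of_pos_right hxy hc0)) hc0
    · have : (fun y => h₀ (c * y) / c) = bump w D := by
        funext y
        rw [h₀_apply, mul_div_cancel_left₀ _ hc0.ne', mul_div_cancel_right₀ _ hc0.ne']
      rw [this]
      exact tbarFun_bump hw hD hD0
  have h₀_per : ∀ (x : ℝ) (m : ℤ), h₀ (x + c * m) = h₀ x + c * m := by
    intro x m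
    rw [h₀_apply, h₀_apply, add_div, mul_div_cancel_left₀ _ hc0.ne', bump_add_int]
    ring
  have h₀_fix : ∀ x : ℝ, (∀ m : ℤ, ¬(u < x - c * m ∧ x - c * m < v)) → h₀ x = x := by
    intro x hx
    obtain ⟨n, r, hxr, hr0, hr1⟩ := bump_decomp w (x / c)
    rw [h₀_apply, bump_eq hxr hr0 hr1]
    have hxc : x = (w + n + r) * c := by rw [← hxr]; field_simp
    have : bumpProfile D r = 0 := by
      by_cases hrD : r < D
      · refine absurd ⟨?_, ?_⟩ (hx n)
        · nlinarith
        · nlinarith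
      · unfold bumpProfile
        grind
    rw [this]
    field_simp
    ring
  obtain ⟨n, hn⟩ := exists_pow_apply_gt h₀ (a := a) (b := b)
      (κ := c * min (a / c - w) (min (D / 4) ((D - (b / c - w)) / 2))) (by
    have h1 : w < a / c := by rwa [lt_div_iff₀ hc0]
    have h2 : b / c < w + D := by rwa [div_lt_iff₀ hc0]
    refine mul_pos hc0 (lt_min (by linarith) (lt_min (by linarith) (by linarith)))) (by
    intro x hax hxb
    have h1 : w < a / c := by rwa [lt_div_iff₀ hc0]
    have h2 : b / c < w + D := by rwa [div_lt_iff₀ hc0]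
    have h3 : a / c ≤ x / c := div_le_div_of_nonneg_right hax hc0.le
    have h4 : x / c ≤ b / c := div_le_div_of_nonneg_right hxb hc0.le
    rw [h₀_apply, bump_eq (n := 0) (r := x / c - w) (by simp) (by linarith) (by linarith),
      add_mul, div_mul_cancel₀ _ hc0.ne', mul_comm c]
    have : min (a / c - w) (min (D / 4) ((D - (b / c - w)) / 2)) ≤
        bumpProfile D (x / c - w) := by
      unfold bumpProfile
      grind
    have := mul_le_mul_of_nonneg_right this hc0.le
    linarith)
  refine ⟨h₀ ^ n, pow_mem h₀_mem n, fun x m => ?_, fun x hx =>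
    Equiv.Perm.pow_apply_eq_self_of_apply_eq_self (h₀_fix x hx) n, hn⟩
  have hcomm : Commute h₀ (Equiv.addRight (c * m)) := Equiv.ext fun y => h₀_per y m
  exact Equiv.congr_fun (hcomm.pow_left n) x

theorem uniformContinuous_of_strictMono_of_periodic {g : Equiv.Perm ℝ} (hg : StrictMono g) {c : ℝ}
    (hc : 0 < c) (hper : ∀ x, g (x + c) = g x + c) : UniformContinuous g := by
  have hcont : Continuous g := hg.monotone.continuous_of_surjective g.surjective
  let F : C(ℝ, ℝ) := ⟨fun x => g x - x, hcont.sub continuous_id⟩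
  have hF : Function.Periodic F c := fun x => by
    change g (x + c) - (x + c) = g x - x
    rw [hper]
    ring
  have hFu : UniformContinuous F := by
    have : Fact (0 < c) := ⟨hc⟩
    have h1 : Continuous (hF.lift : AddCircle c → ℝ) := continuous_coinduced_dom.2 F.continuous
    have h2 := CompactSpace.uniformContinuous_of_continuous h1
    exact h2.comp (uniformContinuous_of_continuousAt_zero (QuotientAddGroup.mk' _)
      (continuous_quotient_mk'.continuousAt))
  have : (g : ℝ → ℝ) = fun x => F x + x := by
    funext x
    simp [F]
  rw [this]
  exact hFu.add uniformContinuous_id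

/-- An increasing bi-uniformly continuous permutation of `ℝ` which almost commutes with
translation by `c * n` whenever `c * n` is close to `d * ℤ`. -/
structure AlmostPeriodic (c d : ℝ) (g : Equiv.Perm ℝ) : Prop where
  strictMono : StrictMono g
  uniformContinuous : UniformContinuous g
  uniformContinuous_inv : UniformContinuous (g⁻¹ : Equiv.Perm ℝ)
  almost_commute : ∀ ε > 0, ∃ δ > 0, ∀ n m : ℤ, |c * n - d * m| < δ →
    ∀ x, |g (x + c * n) - (g x + c * n)| < ε

theorem strictMono_perm_inv {g : Equiv.Perm ℝ} (hg : StrictMono g) :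
    StrictMono (g⁻¹ : Equiv.Perm ℝ) := by
  intro x y hxy
  rw [← hg.lt_iff_lt]
  simpa using hxy

namespace AlmostPeriodic

variable {c d : ℝ}

theorem apply_add_mul_int {g : Equiv.Perm ℝ} (h : ∀ x, g (x + c) = g x + c) (x : ℝ) (n : ℤ) :
    g (x + c * n) = g x + c * n := by
  have hcomm : Commute g (Equiv.addRight c) := Equiv.ext h
  have := Equiv.congr_fun (hcomm.zpow_right n) x
  simpa [mul_comm] using this

theorem of_periodic {e : ℝ} (he : e = c ∨ e = d) (he0 : 0 < e) {g : Equiv.Perm ℝ}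
    (hg : StrictMono g) (hper : ∀ x, g (x + e) = g x + e) : AlmostPeriodic c d g := by
  have huc := uniformContinuous_of_strictMono_of_periodic hg he0 hper
  refine ⟨hg, huc, uniformContinuous_of_strictMono_of_periodic (strictMono_perm_inv hg) he0
    fun x => ?_, fun ε hε => ?_⟩
  · rw [Equiv.Perm.inv_eq_iff_eq, hper]
    simp
  rcases he with rfl | rfl
  · exact ⟨1, one_pos, fun n m _ x => by rw [apply_add_mul_int hper]; simpa using hε⟩
  · obtain ⟨δ, hδ, H⟩ := Metric.uniformContinuous_iff.1 huc (ε / 2) (half_pos hε)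
    refine ⟨min δ (ε / 2), lt_min hδ (half_pos hε), fun n m hnm x => ?_⟩
    have h1 := H (a := x + (c * n - e * m)) (b := x) (by
      rw [Real.dist_eq]
      simpa using hnm.trans_le (min_le_left _ _))
    have h2 := hnm.trans_le (min_le_right _ _)
    have h3 : g (x + c * n) = g (x + (c * n - e * m)) + e * m := by
      rw [← apply_add_mul_int hper]
      ring_nf
    rw [Real.dist_eq] at h1
    rw [h3]
    grind

theorem mul {g h : Equiv.Perm ℝ} (hg : AlmostPeriodic c d g) (hh : AlmostPeriodic c d h) :
    AlmostPeriodic c d (g * h) := by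
  refine ⟨hg.strictMono.comp hh.strictMono, hg.uniformContinuous.comp hh.uniformContinuous, ?_, ?_⟩
  · rw [mul_inv_rev]
    exact hh.uniformContinuous_inv.comp hg.uniformContinuous_inv
  · intro ε hε
    obtain ⟨η, hη, H⟩ := Metric.uniformContinuous_iff.1 hg.uniformContinuous (ε / 2) (half_pos hε)
    obtain ⟨δ₁, hδ₁, H₁⟩ := hg.almost_commute (ε / 2) (half_pos hε)
    obtain ⟨δ₂, hδ₂, H₂⟩ := hh.almost_commute η hη
    refine ⟨min δ₁ δ₂, lt_min hδ₁ hδ₂, fun n m hnm x => ?_⟩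
    have h1 := H₁ n m (hnm.trans_le (min_le_left _ _)) (h x)
    have h2 := H (H₂ n m (hnm.trans_le (min_le_right _ _)) x)
    rw [Real.dist_eq] at h2
    rw [Equiv.Perm.mul_apply, Equiv.Perm.mul_apply]
    grind

theorem inv {g : Equiv.Perm ℝ} (hg : AlmostPeriodic c d g) : AlmostPeriodic c d g⁻¹ := by
  refine ⟨strictMono_perm_inv hg.strictMono, hg.uniformContinuous_inv,
    by simpa using hg.uniformContinuous, fun ε hε => ?_⟩
  obtain ⟨η, hη, H⟩ := Metric.uniformContinuous_iff.1 hg.uniformContinuous_inv ε hε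
  obtain ⟨δ, hδ, H'⟩ := hg.almost_commute η hη
  refine ⟨δ, hδ, fun n m hnm x => ?_⟩
  have h1 := H (H' n m hnm (g⁻¹ x))
  rw [Real.dist_eq, abs_sub_comm] at h1
  simpa using h1

end AlmostPeriodic

theorem AlmostPeriodic.of_mem_Glambda {l c d : ℝ} (hl : 0 < l)
    (hcd : c = 1 ∧ d = l ∨ c = l ∧ d = 1) {g : Equiv.Perm ℝ} (hg : g ∈ Glambda l) :
    AlmostPeriodic c d g := by
  induction hg using Subgroup.closure_induction with
  | mem g hg =>
    rcases hg with hg | hg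
    · exact of_periodic (by tauto) one_pos hg.1 hg.2.1
    · refine of_periodic (e := l) (by tauto) hl hg.1 fun x => ?_
      have := hg.2.1 (x / l)
      simp only [mul_add, mul_one, mul_div_cancel₀ _ hl.ne'] at this
      field_simp at this
      exact this
  | one => exact of_periodic (e := c) (.inl rfl) (by grind) strictMono_id fun x => rfl
  | mul g h _ _ hg hh => exact hg.mul hh
  | inv g _ hg => exact hg.inv

theorem exists_finset_int_approx (c : ℝ) {d δ : ℝ} (hd : 0 < d) (hδ : 0 < δ) :
    ∃ S : Finset ℤ, ∀ n : ℤ, ∃ s ∈ S, ∃ m : ℤ, |c * ((n - s : ℤ) : ℝ) - d * m| < δ := by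
  obtain ⟨K, hK⟩ := exists_nat_gt (d / δ)
  have hK0 : (0 : ℝ) < K := (div_pos hd hδ).trans hK
  let φ : ℤ → ℕ := fun n => ⌊Int.fract (c * n / d) * K⌋₊
  refine ⟨(Finset.range K).image (Function.invFun φ), fun n => ?_⟩
  refine ⟨Function.invFun φ (φ n), Finset.mem_image_of_mem _ ?_, ?_⟩
  · rw [Finset.mem_range, Nat.floor_lt (by positivity)]
    have := Int.fract_lt_one (c * n / d)
    nlinarith
  · obtain ⟨s, hs⟩ : ∃ s, s = Function.invFun φ (φ n) := ⟨_, rfl⟩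
    have hφ : φ s = φ n := hs ▸ Function.invFun_eq ⟨n, rfl⟩
    rw [← hs]
    have hfl : ∀ r : ℤ, (φ r : ℝ) ≤ Int.fract (c * r / d) * K ∧
        Int.fract (c * r / d) * K < φ r + 1 := fun r =>
      ⟨Nat.floor_le (by positivity), Nat.lt_floor_add_one _⟩
    obtain ⟨h1, h2⟩ := hfl n
    obtain ⟨h3, h4⟩ := hfl s
    rw [hφ] at h3 h4
    refine ⟨⌊c * n / d⌋ - ⌊c * s / d⌋, ?_⟩
    have h5 : c * ((n - s : ℤ) : ℝ) - d * ((⌊c * n / d⌋ - ⌊c * s / d⌋ : ℤ) : ℝ) =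
        d * (Int.fract (c * n / d) - Int.fract (c * s / d)) := by
      have e1 := Int.floor_add_fract (c * n / d)
      have e2 := Int.floor_add_fract (c * s / d)
      have e3 : d * (c * n / d) = c * n := by field_simp
      have e4 : d * (c * s / d) = c * s := by field_simp
      push_cast
      linear_combination -e3 + e4 - d * e1 + d * e2
    rw [h5, abs_mul, abs_of_pos hd]
    have h6 : |Int.fract (c * n / d) - Int.fract (c * s / d)| * K < 1 := by
      rcases abs_cases (Int.fract (c * n / d) - Int.fract (c * s / d)) with h | h <;>
        rw [h.1] <;> linarith
    rw [div_lt_iff₀ hδ] at hK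
    have h7 := mul_le_mul_of_nonneg_left hK.le
      (abs_nonneg (Int.fract (c * n / d) - Int.fract (c * s / d)))
    nlinarith

theorem apply_left_endpoint {h : Equiv.Perm ℝ} {c u v : ℝ} (hc : 0 < c)
    (hfix : ∀ x : ℝ, (∀ m : ℤ, ¬(u < x - c * m ∧ x - c * m < v)) → h x = x) {x : ℝ}
    (hvx : v ≤ x + c) (hxu : x ≤ u) : h x = x := by
  refine hfix x fun m hm => ?_
  rcases le_or_gt 0 m with h0 | h0
  · have : (0 : ℝ) ≤ m := by exact_mod_cast h0
    nlinarith
  · have : (m : ℝ) ≤ -1 := by exact_mod_cast Int.le_sub_one_of_lt h0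
    nlinarith

/-- A small bump near `p + cℤ`, moving `p` but not `q`. -/
theorem HasPushes.exists_small_bump {G : Subgroup (Equiv.Perm ℝ)} {c : ℝ} (hG : HasPushes G c)
    (hmono : ∀ g ∈ G, StrictMono g) (hc : 0 < c) {p q ε : ℝ} (hpq : ∀ m : ℤ, q - p ≠ c * m)
    (hε : 0 < ε) :
    ∃ h ∈ G, h p ≠ p ∧ h q = q ∧ (∀ x, |h x - x| < ε) ∧
      ∀ x, (∀ m : ℤ, ε ≤ |x - p - c * m|) → h x = x := by
  have hρ : 0 < |q - p - c * round ((q - p) / c)| := abs_pos.2 (sub_ne_zero.2 (hpq _))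
  have hdist : ∀ m : ℤ, |q - p - c * round ((q - p) / c)| ≤ |q - p - c * m| := by
    have key : ∀ k : ℤ, |q - p - c * k| = c * |(q - p) / c - k| := fun k => by
      rw [← abs_of_pos hc, ← abs_mul, abs_of_pos hc, mul_sub, mul_div_cancel₀ _ hc.ne']
    intro m
    rw [key, key]
    exact mul_le_mul_of_nonneg_left (round_le _ m) hc.le
  obtain ⟨η, hη, hη1, hη2, hη3⟩ : ∃ η > 0, η ≤ ε / 2 ∧ η ≤ c / 2 ∧
      η ≤ |q - p - c * round ((q - p) / c)| :=
    ⟨min (ε / 2) (min (c / 2) |q - p - c * round ((q - p) / c)|), by positivity,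
      min_le_left _ _, (min_le_right _ _).trans (min_le_left _ _),
      (min_le_right _ _).trans (min_le_right _ _)⟩
  obtain ⟨h, hhG, hper, hfix, hp⟩ := hG (p - η) (p + η) p p (by linarith) (by linarith)
    (by linarith) (by linarith) (by linarith)
  have hh := hmono h hhG
  refine ⟨h, hhG, hp.ne', hfix q fun m hm => ?_, fun x => ?_, fun x hx => hfix x fun m hm => ?_⟩
  · have h1 : |q - p - c * m| < η := abs_lt.2 ⟨by linarith, by linarith⟩
    linarith [hdist m]
  · by_cases hx : ∀ m : ℤ, ¬(p - η < x - c * m ∧ x - c * m < p + η)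
    · rw [hfix x hx, sub_self, abs_zero]
      exact hε
    · push Not at hx
      obtain ⟨m, hm1, hm2⟩ := hx
      have hu : h (p - η) = p - η :=
        apply_left_endpoint hc hfix (by linarith) le_rfl
      have hv : h (p + η) = p + η := by
        have h1 := apply_left_endpoint hc hfix (x := p + η - c) (by linarith)
          (by linarith)
        have h2 := hper (p + η - c) 1
        rw [h1] at h2
        simpa using h2
      have h1 : h (p - η + c * m) < h x := hh (by linarith)
      have h2 : h x < h (p + η + c * m) := hh (by linarith)
      rw [hper, hu] at h1
      rw [hper, hv] at h2
      rw [abs_lt]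
      constructor <;> linarith
  · have h1 : |x - p - c * m| < ε := abs_lt.2 ⟨by linarith, by linarith⟩
    linarith [hx m]

/-- An element commuting with translation by `c` and fixing `cℤ` which squeezes `p < y < β` in
`(0, c)` to prescribed positions. -/
theorem HasPushes.exists_squeeze {G : Subgroup (Equiv.Perm ℝ)} {c : ℝ} (hG : HasPushes G c)
    (hmono : ∀ g ∈ G, StrictMono g) {p y β ℓ x z : ℝ} (hp : 0 < p)
    (hpy : p < y) (hyβ : y < β) (hβ : β < c) (hℓ : 0 < ℓ) (hx : 0 < x) (hxz : x < z)
    (hz : z < c) :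
    ∃ h ∈ G, (∀ (t : ℝ) (m : ℤ), h (t + c * m) = h t + c * m) ∧ h 0 = 0 ∧
      h p < ℓ ∧ x < h y ∧ h β < z := by
  have hc : 0 < c := by linarith
  obtain ⟨h₁, hG₁, per₁, fix₁, lt₁⟩ := hG 0 c z β (by linarith) hz (by linarith) hβ (by linarith)
  have inv_per : ∀ {h : Equiv.Perm ℝ}, (∀ (t : ℝ) (m : ℤ), h (t + c * m) = h t + c * m) →
      ∀ (t : ℝ) (m : ℤ), h⁻¹ (t + c * m) = h⁻¹ t + c * m := fun hh t m => by
    rw [Equiv.Perm.inv_eq_iff_eq, hh]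
    simp
  have zero₁ : h₁⁻¹ 0 = 0 := by
    rw [Equiv.Perm.inv_eq_iff_eq,
      apply_left_endpoint hc fix₁ (by linarith) le_rfl]
  have mono₁ := hmono _ (inv_mem hG₁)
  have hβ₁ : h₁⁻¹ β < z := by
    have := mono₁ lt₁
    simpa using this
  have hp₁ : 0 < h₁⁻¹ p := by
    rw [← zero₁]
    exact mono₁ hp
  have hpy₁ := mono₁ hpy
  have hyβ₁ := mono₁ hyβ
  obtain ⟨h₂, hG₂, per₂, fix₂, lt₂⟩ := hG 0 z (h₁⁻¹ y) x (by linarith) (by linarith) hx hxz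
    (by linarith)
  have mono₂ := hmono _ hG₂
  have fix_Icc : ∀ {h : Equiv.Perm ℝ} {v : ℝ}, v ≤ c →
      (∀ (t : ℝ) (m : ℤ), h (t + c * m) = h t + c * m) →
      (∀ t : ℝ, (∀ m : ℤ, ¬(0 < t - c * m ∧ t - c * m < v)) → h t = t) →
      ∀ t, v ≤ t → t ≤ c → h t = t := by
    intro h v hv hper hfix t hvt htc
    have h1 := apply_left_endpoint hc hfix (x := t - c) (by linarith) (by linarith)
    have h2 := hper (t - c) 1
    rw [h1] at h2
    simpa using h2
  have zero₂ : h₂ 0 = 0 := apply_left_endpoint hc fix₂ (by linarith) le_rfl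
  have z₂ : h₂ z = z := fix_Icc hz.le per₂ fix₂ z le_rfl hz.le
  have hβ₂ : h₂ (h₁⁻¹ β) < z := by
    rw [← z₂]
    exact mono₂ hβ₁
  have hp₂ : 0 < h₂ (h₁⁻¹ p) := by
    rw [← zero₂]
    exact mono₂ hp₁
  have hpy₂ := mono₂ hpy₁
  have hyβ₂ := mono₂ hyβ₁
  obtain ⟨h₃, hG₃, per₃, fix₃, lt₃⟩ := hG 0 (h₂ (h₁⁻¹ y)) (min ℓ (h₂ (h₁⁻¹ p))) (h₂ (h₁⁻¹ p))
    (lt_min hℓ hp₂) ((min_le_right _ _).trans_lt hpy₂) hp₂ hpy₂ (by linarith)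
  have mono₃ := hmono _ (inv_mem hG₃)
  refine ⟨h₃⁻¹ * h₂ * h₁⁻¹, mul_mem (mul_mem (inv_mem hG₃) hG₂) (inv_mem hG₁), fun t m => ?_,
    ?_, ?_, ?_, ?_⟩ <;> simp only [Equiv.Perm.mul_apply]
  · rw [inv_per per₁, per₂, inv_per per₃]
  · rw [zero₁, zero₂, Equiv.Perm.inv_eq_iff_eq,
      apply_left_endpoint hc fix₃ (by linarith) le_rfl]
  · have := mono₃ lt₃
    simp only [Equiv.Perm.inv_def, Equiv.symm_apply_apply] at this
    exact this.trans_le (min_le_left _ _)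
  · have : h₃⁻¹ (h₂ (h₁⁻¹ y)) = h₂ (h₁⁻¹ y) := by
      rw [Equiv.Perm.inv_eq_iff_eq]
      exact (fix_Icc (by linarith) per₃ fix₃ _ le_rfl (by linarith)).symm
    rw [this]
    exact lt₂
  · have : h₃⁻¹ z = z := by
      rw [Equiv.Perm.inv_eq_iff_eq]
      exact (fix_Icc (by linarith) per₃ fix₃ _ (by linarith) hz.le).symm
    rw [← this]
    exact mono₃ hβ₂

theorem conj_addRight_apply (g : Equiv.Perm ℝ) (a t : ℝ) :
    (Equiv.addRight a * g * (Equiv.addRight a)⁻¹) t = g (t - a) + a := by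
  simp [Equiv.Perm.inv_def, sub_eq_add_neg]

section ConjugationInvariant

variable {G N : Subgroup (Equiv.Perm ℝ)} {c d : ℝ}

theorem commutator_mem (hN : ∀ g ∈ G, ∀ n ∈ N, g * n * g⁻¹ ∈ N)
    {f h : Equiv.Perm ℝ} (hf : f ∈ N) (hh : h ∈ G) : f * h * f⁻¹ * h⁻¹ ∈ N := by
  have := mul_mem hf (hN h hh _ (inv_mem hf))
  simpa only [mul_assoc] using this

theorem commutator_ne_one {f h : Equiv.Perm ℝ} {p : ℝ} (hp : h p ≠ p) (hfp : h (f p) = f p) :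
    f * h * f⁻¹ * h⁻¹ ≠ 1 := by
  intro h1
  rw [mul_inv_eq_one, mul_inv_eq_iff_eq_mul] at h1
  have := Equiv.congr_fun h1 p
  rw [Equiv.Perm.mul_apply, Equiv.Perm.mul_apply, hfp] at this
  exact hp (f.injective this)

theorem exists_small_mem (hNG : N ≤ G) (hN : ∀ g ∈ G, ∀ n ∈ N, g * n * g⁻¹ ∈ N)
    (hG : ∀ g ∈ G, AlmostPeriodic c d g) (hc : 0 < c) (hd : 0 < d) (hGc : HasPushes G c)
    (hGd : HasPushes G d) (hcd : ∀ m n : ℤ, c * m = d * n → c * m = 0)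
    {f : Equiv.Perm ℝ} (hf : f ∈ N) (hf1 : f ≠ 1) {ε : ℝ} (hε : 0 < ε) :
    ∃ g ∈ N, g ≠ 1 ∧ ∀ x, |g x - x| < ε := by
  obtain ⟨p, hp⟩ : ∃ p, f p ≠ p := by
    by_contra! h
    exact hf1 (Equiv.ext h)
  obtain ⟨δ, hδ, H⟩ := Metric.uniformContinuous_iff.1 (hG f (hNG hf)).uniformContinuous (ε / 2)
    (half_pos hε)
  have hmono : ∀ g ∈ G, StrictMono g := fun g hg => (hG g hg).strictMono
  obtain ⟨h, hh, hhp, hhq, hsmall⟩ : ∃ h ∈ G, h p ≠ p ∧ h (f p) = f p ∧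
      ∀ x, |h x - x| < min δ (ε / 2) := by
    have hmin := lt_min hδ (half_pos hε)
    by_cases hpc : ∀ m : ℤ, f p - p ≠ c * m
    · obtain ⟨h, h1, h2, h3, h4, -⟩ := hGc.exists_small_bump hmono hc hpc hmin
      exact ⟨h, h1, h2, h3, h4⟩
    · have hpd : ∀ m : ℤ, f p - p ≠ d * m := by
        push Not at hpc
        obtain ⟨m, hm⟩ := hpc
        intro n hn
        have := hcd m n (hm.symm.trans hn)
        exact hp (by linarith)
      obtain ⟨h, h1, h2, h3, h4, -⟩ := hGd.exists_small_bump hmono hd hpd hmin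
      exact ⟨h, h1, h2, h3, h4⟩
  refine ⟨_, commutator_mem hN hf hh, commutator_ne_one hhp hhq, fun x => ?_⟩
  have h1 := (hsmall (h⁻¹ x)).trans_le (min_le_right _ _)
  have h2 := H (((Real.dist_eq _ _).trans_lt (hsmall (f⁻¹ (h⁻¹ x)))).trans_le (min_le_left _ _))
  rw [Real.dist_eq] at h2
  simp only [Equiv.Perm.inv_def, Equiv.apply_symm_apply] at h1 h2
  simp only [Equiv.Perm.inv_def, Equiv.Perm.mul_apply]
  grind

/-- A nontrivial element of `N` supported in `(c/8, 7c/8) + cℤ`. -/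
theorem exists_mem_fixing (hNG : N ≤ G) (hN : ∀ g ∈ G, ∀ n ∈ N, g * n * g⁻¹ ∈ N)
    (hG : ∀ g ∈ G, AlmostPeriodic c d g) (hc : 0 < c) (hd : 0 < d) (hGc : HasPushes G c)
    (hGd : HasPushes G d) (hcd : ∀ m n : ℤ, c * m = d * n → c * m = 0)
    (htrans : ∀ a : ℝ, Equiv.addRight (c * a) ∈ G)
    {f : Equiv.Perm ℝ} (hf : f ∈ N) (hf1 : f ≠ 1) :
    ∃ g ∈ N, g ≠ 1 ∧
      ∀ x : ℝ, (∀ m : ℤ, ¬(c / 8 < x - c * m ∧ x - c * m < 7 * c / 8)) → g x = x := by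
  obtain ⟨f₁, hf₁, hf₁1, hsmall₁⟩ := exists_small_mem hNG hN hG hc hd hGc hGd hcd hf hf1
    (ε := c / 8) (by linarith)
  obtain ⟨p, hp⟩ : ∃ p, f₁ p ≠ p := by
    by_contra! h
    exact hf₁1 (Equiv.ext h)
  obtain ⟨f₂, hf₂, hsmall, hf₂p⟩ : ∃ f₂ ∈ N, (∀ x, |f₂ x - x| < c / 8) ∧ f₂ (c / 2) ≠ c / 2 := by
    have ht := htrans (1 / 2 - p / c)
    have hca : c * (1 / 2 - p / c) = c / 2 - p := by field_simp
    rw [hca] at ht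
    refine ⟨_, hN _ ht _ hf₁, fun x => ?_, ?_⟩
    · have := hsmall₁ (x - (c / 2 - p))
      rw [conj_addRight_apply]
      convert this using 2
      ring
    · rw [conj_addRight_apply]
      intro h
      apply hp
      rw [show c / 2 - (c / 2 - p) = p by ring] at h
      linarith
  have hne : ∀ m : ℤ, f₂ (c / 2) - c / 2 ≠ c * m := by
    intro m hm
    have h1 := hsmall (c / 2)
    rw [hm, abs_mul, abs_of_pos hc] at h1
    have h2 : |(m : ℝ)| < 1 := by nlinarith
    have h3 : m = 0 := Int.abs_lt_one_iff.1 (by exact_mod_cast h2)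
    rw [h3, Int.cast_zero, mul_zero, sub_eq_zero] at hm
    exact hf₂p hm
  obtain ⟨h, hh, h1, h2, -, hfix⟩ := hGc.exists_small_bump
    (fun g hg => (hG g hg).strictMono) hc hne (ε := c / 8) (by linarith)
  refine ⟨_, commutator_mem hN hf₂ hh, commutator_ne_one h1 h2, fun x hx => ?_⟩
  have hx1 : h x = x := by
    refine hfix x fun m => ?_
    by_contra! hm
    rw [abs_lt] at hm
    exact hx m ⟨by linarith, by linarith⟩
  have hx2 : h (f₂⁻¹ x) = f₂⁻¹ x := by
    refine hfix _ fun m => ?_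
    by_contra! hm
    have h3 := hsmall (f₂⁻¹ x)
    simp only [Equiv.Perm.inv_def, Equiv.apply_symm_apply] at h3 hm
    rw [abs_lt] at hm h3
    exact hx m ⟨by linarith, by linarith⟩
  have hx3 : h⁻¹ x = x := by rw [Equiv.Perm.inv_eq_iff_eq, hx1]
  simp only [Equiv.Perm.mul_apply, hx3, hx2]
  simp

/-- Finitely many elements of `N`, each moving `p + c * n` above `y + c * n` for `n` in some set,
can be combined into a single one that does so for all these `n` at once. -/
theorem exists_combined_push (hN : ∀ g ∈ G, ∀ n ∈ N, g * n * g⁻¹ ∈ N)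
    (hNG : N ≤ G) (hmono : ∀ g ∈ G, StrictMono g) (hGc : HasPushes G c) {α p y β : ℝ}
    (hα : 0 < α) (hαp : α < p) (hpy : p < y) (hyβ : y < β) (hβ : β < c) {ι : Type*}
    (g : ι → Equiv.Perm ℝ) (hg : ∀ s, g s ∈ N) (hg0 : ∀ s (n : ℤ), g s (c * n) = c * n)
    (hgα : ∀ s (n : ℤ), g s (α + c * n) = α + c * n)
    (hgβ : ∀ s (n : ℤ), g s (β + c * n) = β + c * n) {x : ℝ} (hx : 0 < x) (hxc : x < c)
    (S : Finset ι) :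
    ∃ W ∈ N, (∀ n : ℤ, W (c * n) = c * n) ∧ ∃ ℓ > 0, ∃ z, x < z ∧ z < c ∧
      ∀ n : ℤ, ℓ + c * n < W (x + c * n) ∧
        ((∃ s ∈ S, y + c * n < g s (p + c * n)) → z + c * n < W (x + c * n)) := by
  classical
  induction S using Finset.induction_on with
  | empty =>
    exact ⟨1, one_mem N, fun n => rfl, x / 2, by linarith, (x + c) / 2, by linarith, by linarith,
      fun n => ⟨by rw [Equiv.Perm.one_apply]; linarith, by simp⟩⟩
  | insert s S _ ih =>
    obtain ⟨W, hW, hW0, ℓ, hℓ, z, hxz, hzc, H⟩ := ih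
    obtain ⟨h, hh, hper, h0, hp, hy, hβz⟩ := hGc.exists_squeeze hmono (by linarith) hpy hyβ hβ hℓ
      hx hxz hzc
    have hh' := hmono h hh
    have hs := hmono _ (hNG (hg s))
    have hconj : ∀ t, (h * g s * h⁻¹) (h t) = h (g s t) := fun t => by simp
    have hk : h * g s * h⁻¹ ∈ N := hN h hh _ (hg s)
    have hkm := hmono _ (hNG hk)
    refine ⟨h * g s * h⁻¹ * W, mul_mem hk hW, fun n => ?_, h α, ?_, h y, hy, ?_, fun n => ?_⟩
    · have h1 : h (c * n) = c * n := by simpa [h0] using hper 0 n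
      rw [Equiv.Perm.mul_apply, hW0]
      nth_rewrite 1 [← h1]
      rw [hconj, hg0, h1]
    · rw [← h0]
      exact hh' hα
    · exact (hh' hyβ).trans (hβz.trans hzc)
    · obtain ⟨H1, H2⟩ := H n
      have hpW : h (p + c * n) < W (x + c * n) := by
        rw [hper]
        linarith
      rw [Equiv.Perm.mul_apply]
      refine ⟨?_, ?_⟩
      · have h1 : h (α + c * n) < W (x + c * n) := (hh' (by linarith)).trans hpW
        have h2 := hkm h1
        rwa [hconj, hgα, hper] at h2
      · rintro ⟨r, hr, hrn⟩
        rcases Finset.mem_insert.1 hr with rfl | hr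
        · have h2 := hkm hpW
          rw [hconj] at h2
          rw [← hper]
          exact (hh' hrn).trans h2
        · have h1 : h (β + c * n) < W (x + c * n) := by
            rw [hper]
            linarith [H2 ⟨r, hr, hrn⟩]
          have h2 := hkm h1
          rw [hconj, hgβ] at h2
          rw [← hper]
          exact (hh' (by linarith)).trans h2

theorem exists_mem_pushing (hNG : N ≤ G) (hN : ∀ g ∈ G, ∀ n ∈ N, g * n * g⁻¹ ∈ N)
    (hG : ∀ g ∈ G, AlmostPeriodic c d g) (hc : 0 < c) (hd : 0 < d) (hGc : HasPushes G c)
    (hGd : HasPushes G d) (hcd : ∀ m n : ℤ, c * m = d * n → c * m = 0)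
    (htrans : ∀ a : ℝ, Equiv.addRight (c * a) ∈ G)
    {f : Equiv.Perm ℝ} (hf : f ∈ N) (hf1 : f ≠ 1) :
    ∃ g ∈ N, (∀ m : ℤ, g (c * m) = c * m) ∧
      ∃ x ∈ Icc (0 : ℝ) c, ∃ y ∈ Icc (0 : ℝ) c, x < y ∧ ∀ n : ℤ, g (x + c * n) > y + c * n := by
  have hmono : ∀ g ∈ G, StrictMono g := fun g hg => (hG g hg).strictMono
  obtain ⟨g, hg, q, hfix, hq⟩ : ∃ g ∈ N, ∃ q,
      (∀ x : ℝ, (∀ m : ℤ, ¬(c / 8 < x - c * m ∧ x - c * m < 7 * c / 8)) → g x = x) ∧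
        q < g q := by
    obtain ⟨g, hg, hg1, hfix⟩ := exists_mem_fixing hNG hN hG hc hd hGc hGd hcd htrans hf hf1
    obtain ⟨q, hq⟩ : ∃ q, g q ≠ q := by
      by_contra! h
      exact hg1 (Equiv.ext h)
    rcases lt_or_gt_of_ne hq with h | h
    · refine ⟨g⁻¹, inv_mem hg, q, fun x hx => ?_, ?_⟩
      · rw [Equiv.Perm.inv_eq_iff_eq, hfix x hx]
      · have := hmono _ (inv_mem (hNG hg)) h
        simpa using this
    · exact ⟨g, hg, q, hfix, h⟩
  have hgm := hmono g (hNG hg)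
  have hfix' : ∀ t : ℝ, 7 * c / 8 ≤ t + c → t ≤ c / 8 → ∀ n : ℤ, g (t + c * n) = t + c * n := by
    intro t ht1 ht2 n
    refine hfix _ fun m => ?_
    have : t + c * n - c * m = t - c * ((m - n : ℤ) : ℝ) := by push_cast; ring
    rw [this]
    rintro ⟨h1, h2⟩
    rcases le_or_gt 0 (m - n) with h0 | h0
    · have : (0 : ℝ) ≤ ((m - n : ℤ) : ℝ) := by exact_mod_cast h0
      nlinarith
    · have : ((m - n : ℤ) : ℝ) ≤ -1 := by exact_mod_cast Int.le_sub_one_of_lt h0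
      nlinarith
  have hg0 : ∀ n : ℤ, g (c * n) = c * n := fun n => by
    simpa using hfix' 0 (by linarith) (by linarith) n
  have hgα : ∀ n : ℤ, g (c / 8 + c * n) = c / 8 + c * n :=
    hfix' _ (by linarith) le_rfl
  have hgβ : ∀ n : ℤ, g (7 * c / 8 + c * n) = 7 * c / 8 + c * n := fun n => by
    have := hfix' (7 * c / 8 - c) (by linarith) (by linarith) (n + 1)
    rwa [show 7 * c / 8 - c + c * ((n + 1 : ℤ) : ℝ) = 7 * c / 8 + c * n by push_cast; ring] at this
  obtain ⟨k, hk1, hk2⟩ : ∃ k : ℤ, c / 8 < q - c * k ∧ q - c * k < 7 * c / 8 := by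
    by_contra! h
    exact hq.ne' (hfix q fun m hm => absurd (h m hm.1) (not_le.2 hm.2))
  have hgqβ : g q < 7 * c / 8 + c * k := by
    rw [← hgβ]
    exact hgm (by linarith)
  obtain ⟨p, rfl⟩ : ∃ p, q = p + c * k := ⟨q - c * k, by ring⟩
  obtain ⟨y, hy1, hy2⟩ := exists_between hq
  obtain ⟨δ, hδ, H⟩ := (hG g (hNG hg)).almost_commute (g (p + c * k) - y) (by linarith)
  obtain ⟨S, hS⟩ := exists_finset_int_approx c hd hδ
  have htr : ∀ s : ℤ, Equiv.addRight (c * (s : ℝ)) ∈ G := fun s => htrans s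
  let gs : ℤ → Equiv.Perm ℝ := fun s =>
    Equiv.addRight (c * (s : ℝ)) * g * (Equiv.addRight (c * (s : ℝ)))⁻¹
  have hgs : ∀ s t, gs s t = g (t - c * s) + c * s := fun s t => conj_addRight_apply g _ t
  have hshift : ∀ t : ℝ, (∀ n : ℤ, g (t + c * n) = t + c * n) →
      ∀ s (n : ℤ), gs s (t + c * n) = t + c * n := by
    intro t ht s n
    have := ht (n - s)
    push_cast at this
    rw [hgs, show t + c * n - c * s = t + c * (n - s) by ring, this]
    ring
  obtain ⟨W, hW, hW0, _, _, z, hxz, hzc, HW⟩ := exists_combined_push (α := c / 8) (p := p)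
    (y := y - c * k) (β := 7 * c / 8) (x := c / 2) hN hNG hmono hGc (by linarith) (by linarith)
    (by linarith) (by linarith) (by linarith) gs (fun s => hN _ (htr s) _ hg)
    (fun s n => by simpa using hshift 0 (by simpa using hg0) s n) (hshift _ hgα) (hshift _ hgβ)
    (by linarith) (by linarith) S
  refine ⟨W, hW, hW0, c / 2, ⟨by linarith, by linarith⟩, z, ⟨by linarith, hzc.le⟩, hxz,
    fun n => (HW n).2 ?_⟩
  obtain ⟨s, hs, m, hm⟩ := hS (n - k)
  refine ⟨s, hs, ?_⟩
  have h1 := abs_lt.1 (H _ m hm (p + c * k))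
  push_cast at h1
  rw [hgs, show p + c * n - c * s = p + c * k + c * (n - k - s) by ring]
  linarith [h1.1]

end ConjugationInvariant

/-- Proposition 2.2 of the paper. For irrational `λ > 1`, any
nontrivial `f ∈ G_λ` and `c ∈ {1, λ}`, the normal closure of `f` in `G_λ` contains an
element `g` fixing `c·ℤ` pointwise and moving `x + c·n` above `y + c·n` for all `n ∈ ℤ`,
for some fixed `x < y` in `[0, c]`. -/
theorem stmt_6 (l : ℝ) (hl : 1 < l) (hirr : Irrational l)
    (f : ↥(Glambda l)) (hf : f ≠ 1) (c : ℝ) (hc : c = 1 ∨ c = l) :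
    ∃ g ∈ Subgroup.normalClosure ({f} : Set ↥(Glambda l)),
      (∀ m : ℤ, (g : Equiv.Perm ℝ) (c * m) = c * m) ∧
      ∃ x ∈ Set.Icc (0 : ℝ) c, ∃ y ∈ Set.Icc (0 : ℝ) c, x < y ∧
        ∀ n : ℤ, (g : Equiv.Perm ℝ) (x + c * n) > y + c * n := by
  have hl0 : 0 < l := one_pos.trans hl
  obtain ⟨d, hcd, hd⟩ : ∃ d, (c = 1 ∧ d = l ∨ c = l ∧ d = 1) ∧ (d = 1 ∨ d = l) := by
    rcases hc with rfl | rfl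
    · exact ⟨l, by simp⟩
    · exact ⟨1, by simp⟩
  have hc0 : 0 < c := by rcases hc with rfl | rfl <;> linarith
  have hd0 : 0 < d := by rcases hd with rfl | rfl <;> linarith
  have hindep : ∀ m n : ℤ, (m : ℝ) = l * n → n = 0 := by
    intro m n h
    by_contra hn
    exact (hirr.mul_intCast hn).ne_int m h.symm
  have hcd0 : ∀ m n : ℤ, c * m = d * n → c * m = 0 := by
    intro m n h
    rcases hcd with ⟨rfl, rfl⟩ | ⟨rfl, rfl⟩
    · rw [h, hindep m n (by simpa using h)]
      simp
    · rw [hindep n m (by simpa using h.symm)]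
      simp
  let N := (Subgroup.normalClosure ({f} : Set ↥(Glambda l))).map (Glambda l).subtype
  have hNG : N ≤ Glambda l := Subgroup.map_subtype_le _
  have hN : ∀ g ∈ Glambda l, ∀ n ∈ N, g * n * g⁻¹ ∈ N := by
    rintro g hg _ ⟨n, hn, rfl⟩
    exact ⟨_, Subgroup.normalClosure_normal.conj_mem n hn ⟨g, hg⟩, rfl⟩
  have hfN : (f : Equiv.Perm ℝ) ∈ N :=
    ⟨f, Subgroup.subset_normalClosure rfl, rfl⟩
  obtain ⟨_, ⟨g, hg, rfl⟩, hg'⟩ := exists_mem_pushing (d := d) hNG hN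
    (fun g hg => AlmostPeriodic.of_mem_Glambda hl0 hcd hg) hc0 hd0 (hasPushes_Glambda hc hc0)
    (hasPushes_Glambda hd hd0) hcd0 (addRight_mem_Glambda hc hc0) hfN (by simpa using hf)
  exact ⟨g, hg, hg'⟩
end
end

section
/- Let λ > 1 be irrational and let g₁ = u₁v₁⋯u_nv_n ∈ G_λ where u_i ∈ T̄ and v_i ∈ T̄_λ for each 1 ≤ i ≤ n. For every ε > 0 there exists δ₁ > 0 such that for every δ ∈ (−δ₁, δ₁), writing f_δ for the translation x·f_δ = x + δ, the element g₂ = u₁(f_δ⁻¹v₁f_δ)⋯u_n(f_δ⁻¹v_nf_δ) satisfies sup_{x ∈ [0,1]} |x·g₁ − x·g₂| < ε. -/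
open Set

noncomputable section

/-- `rword [w₁, …, w_k]` is the homeomorphism given by the word `w₁w₂⋯w_k` in the
right-action convention: apply `w₁` first, then `w₂`, and so on. -/
def rword (ws : List (Equiv.Perm ℝ)) : Equiv.Perm ℝ := ws.reverse.prod

theorem rword_nil : rword [] = 1 := rfl

theorem rword_cons_apply (w : Equiv.Perm ℝ) (ws : List (Equiv.Perm ℝ)) (x : ℝ) :
    rword (w :: ws) x = rword ws (w x) := by
  simp [rword]

/-- Evaluation of a word in which every second letter is conjugated by a translation is jointly
continuous in the translation length and the point. -/
theorem continuous_rword_conj {ι : Type*} (u v : ι → Equiv.Perm ℝ)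
    (hu : ∀ i, Continuous (u i)) (hv : ∀ i, Continuous (v i)) (L : List ι) :
    Continuous fun p : ℝ × ℝ =>
      rword ((L.map fun i =>
        [u i, Equiv.addRight p.1 * v i * (Equiv.addRight p.1)⁻¹]).flatten) p.2 := by
  induction L with
  | nil => simpa [rword_nil] using continuous_snd
  | cons i L ih =>
    have hui := hu i
    have hvi := hv i
    have h : Continuous fun p : ℝ × ℝ => (p.1, v i (u i p.2 + -p.1) + p.1) := by fun_prop
    refine (ih.comp h).congr fun p => ?_
    simp [rword_cons_apply]

/-- Lemma 2.5 of the paper. Perturbing each `T̄_λ`-letter of a word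
`g₁ = u₁v₁⋯u_nv_n` by conjugating with a small translation `f_δ` changes the word by at
most `ε` in the sup-metric on `[0,1]`. -/
theorem stmt_7 (l : ℝ) (hl : 1 < l) (hirr : Irrational l)
    (n : ℕ) (u v : Fin n → Equiv.Perm ℝ)
    (hu : ∀ i, u i ∈ Tbar) (hv : ∀ i, v i ∈ TbarL l)
    (ε : ℝ) (hε : 0 < ε) :
    ∃ δ₁ : ℝ, 0 < δ₁ ∧ ∀ δ : ℝ, δ ∈ Set.Ioo (-δ₁) δ₁ →
      (⨆ x : ↥(Set.Icc (0 : ℝ) 1),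
        |rword (((List.finRange n).map fun i => [u i, v i]).flatten) (x : ℝ) -
          rword (((List.finRange n).map fun i =>
            [u i, Equiv.addRight δ * v i * (Equiv.addRight δ)⁻¹]).flatten) (x : ℝ)|) < ε := by
  have hcont (w : Equiv.Perm ℝ) (hw : StrictMono w) : Continuous w :=
    hw.monotone.continuous_of_surjective w.surjective
  have hF := continuous_rword_conj u v (fun i => hcont _ (hu i).1) (fun i => hcont _ (hv i).1)
    (List.finRange n)
  set F : ℝ × ℝ → ℝ := fun p => rword (((List.finRange n).map fun i =>
    [u i, Equiv.addRight p.1 * v i * (Equiv.addRight p.1)⁻¹]).flatten) p.2 with hFdef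
  have hzero (x : ℝ) :
      rword (((List.finRange n).map fun i => [u i, v i]).flatten) x = F (0, x) := by
    simp [hFdef]
  have hev : ∀ᶠ δ in nhds (0 : ℝ), ∀ x ∈ Icc (0 : ℝ) 1, |F (0, x) - F (δ, x)| < ε / 2 := by
    refine isCompact_Icc.eventually_forall_of_forall_eventually fun x _ => ?_
    have hG : Continuous fun p : ℝ × ℝ => |F (0, p.2) - F (p.1, p.2)| := by fun_prop
    exact hG.continuousAt.eventually_lt_const (by simpa using hε)
  obtain ⟨δ₁, hδ₁, hball⟩ := Metric.eventually_nhds_iff.mp hev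
  refine ⟨δ₁, hδ₁, fun δ hδ => ?_⟩
  have hlt := hball (show dist δ 0 < δ₁ by simpa [Real.dist_eq] using abs_lt.mpr hδ)
  have : Nonempty (Icc (0 : ℝ) 1) := ⟨⟨0, by simp⟩⟩
  refine (ciSup_le fun x => ?_).trans_lt (half_lt_self hε)
  rw [hzero]
  exact (hlt x x.2).le
end
end

section
/- Let λ > 1 be irrational. Every g ∈ G_λ is repetitive: for every ε > 0 there exists N ∈ ℕ such that every interval I ⊆ ℝ of length greater than N contains an interval [m, m+1] with m ∈ ℤ such that sup_{x ∈ [0,1]} |x·g − ((x+m)·g − m)| < ε. -/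
open Set

noncomputable section

/-- `g` almost commutes with every integer translation by an amount close to `lℤ`, uniformly in
the base point. Taking `m = k = 0`, this includes uniform continuity of `g`. -/
def AlmostEquivariant (l : ℝ) (g : ℝ → ℝ) : Prop :=
  ∀ ε : ℝ, 0 < ε → ∃ δ : ℝ, 0 < δ ∧ ∀ (m k : ℤ) (x y : ℝ),
    |(m : ℝ) - k * l| < δ → |y - x - m| < δ → |g y - g x - m| < ε

theorem AlmostEquivariant.id (l : ℝ) : AlmostEquivariant l fun x => x :=
  fun ε hε => ⟨ε, hε, fun _ _ _ _ _ h => h⟩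

theorem AlmostEquivariant.comp {l : ℝ} {g h : ℝ → ℝ} (hg : AlmostEquivariant l g)
    (hh : AlmostEquivariant l h) : AlmostEquivariant l fun x => g (h x) := by
  intro ε hε
  obtain ⟨δ₁, hδ₁, H₁⟩ := hg ε hε
  obtain ⟨δ₂, hδ₂, H₂⟩ := hh δ₁ hδ₁
  refine ⟨min δ₁ δ₂, lt_min hδ₁ hδ₂, fun m k x y hmk hxy => ?_⟩
  exact H₁ m k _ _ (hmk.trans_le (min_le_left _ _))
    (H₂ m k x y (hmk.trans_le (min_le_right _ _)) (hxy.trans_le (min_le_right _ _)))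

theorem map_add_int_mul {p : ℝ} {g : ℝ → ℝ} (hp : ∀ x, g (x + p) = g x + p) (k : ℤ) (x : ℝ) :
    g (x + k * p) = g x + k * p := by
  have hper : Function.Periodic (fun x => g x - x) p := fun x => by
    simp only [hp]
    ring
  have h := hper.int_mul k x
  linarith

theorem uniformContinuous_of_strictMono_of_map_add {p : ℝ} (hp0 : 0 < p) (g : Equiv.Perm ℝ)
    (hg : StrictMono g) (hp : ∀ x, g (x + p) = g x + p) : UniformContinuous g := by
  have hc : Continuous g := hg.monotone.continuous_of_surjective g.surjective
  have hper : Function.Periodic (fun x => g x - x) p := fun x => by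
    simp only [hp]
    ring
  have : Fact (0 < p) := ⟨hp0⟩
  have hlift : Continuous hper.lift :=
    continuous_quot_lift _ (hc.sub continuous_id)
  have hcoe : UniformContinuous ((↑) : ℝ → AddCircle p) :=
    uniformContinuous_addMonoidHom_of_continuous (f := QuotientAddGroup.mk' _)
      (AddCircle.continuous_mk' p)
  have hu := ((CompactSpace.uniformContinuous_of_continuous hlift).comp hcoe).add
    uniformContinuous_id
  simpa [Function.comp_def] using hu

theorem almostEquivariant_of_map_add_one (l : ℝ) (g : Equiv.Perm ℝ) (hg : StrictMono g)
    (hp : ∀ x, g (x + 1) = g x + 1) : AlmostEquivariant l g := by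
  intro ε hε
  obtain ⟨δ, hδ, H⟩ := Metric.uniformContinuous_iff.1
    (uniformContinuous_of_strictMono_of_map_add one_pos g hg hp) ε hε
  refine ⟨δ, hδ, fun m k x y _ hxy => ?_⟩
  have h1 := map_add_int_mul hp m (y - m)
  have h2 : dist (g (y - m)) (g x) < ε := H (by
    rw [Real.dist_eq]
    convert hxy using 2
    ring)
  rw [Real.dist_eq] at h2
  simp only [mul_one, sub_add_cancel] at h1
  rw [h1]
  convert h2 using 2
  ring

theorem almostEquivariant_of_map_add {l : ℝ} (hl : 0 < l) (g : Equiv.Perm ℝ) (hg : StrictMono g)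
    (hp : ∀ x, g (x + l) = g x + l) : AlmostEquivariant l g := by
  intro ε hε
  obtain ⟨δ, hδ, H⟩ := Metric.uniformContinuous_iff.1
    (uniformContinuous_of_strictMono_of_map_add hl g hg hp) (ε / 2) (half_pos hε)
  refine ⟨min (δ / 2) (ε / 2), by positivity, fun m k x y hmk hxy => ?_⟩
  obtain ⟨hmk₁, hmk₂⟩ := lt_min_iff.1 hmk
  have hxy₁ := (lt_min_iff.1 hxy).1
  rw [abs_lt] at hmk₁ hmk₂ hxy₁
  have h1 := map_add_int_mul hp k (y - k * l)
  have h2 : dist (g (y - k * l)) (g x) < ε / 2 := H (by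
    rw [Real.dist_eq, abs_lt]
    constructor <;> linarith)
  rw [Real.dist_eq, abs_lt] at h2
  simp only [sub_add_cancel] at h1
  rw [h1, abs_lt]
  constructor <;> linarith

theorem strictMono_inv (g : Equiv.Perm ℝ) (hg : StrictMono g) : StrictMono ⇑g⁻¹ :=
  fun x y hxy => hg.lt_iff_lt.1 (by simpa using hxy)

theorem inv_map_add {p : ℝ} (g : Equiv.Perm ℝ) (hp : ∀ x, g (x + p) = g x + p) (x : ℝ) :
    g⁻¹ (x + p) = g⁻¹ x + p :=
  g.injective (by simp [hp])

theorem almostEquivariant_of_mem_Glambda {l : ℝ} (hl : 0 < l) {g : Equiv.Perm ℝ}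
    (hg : g ∈ Glambda l) : AlmostEquivariant l g ∧ AlmostEquivariant l ⇑g⁻¹ := by
  induction hg using Subgroup.closure_induction with
  | mem g hg =>
    rcases hg with ⟨hmono, hp, -⟩ | ⟨hmono, hp, -⟩
    · exact ⟨almostEquivariant_of_map_add_one l g hmono hp,
        almostEquivariant_of_map_add_one l _ (strictMono_inv g hmono) (inv_map_add g hp)⟩
    · have hp' : ∀ x, g (x + l) = g x + l := fun x => by
        have h := hp (x / l)
        simp only [mul_add, mul_one, mul_div_cancel₀ _ hl.ne'] at h
        field_simp at h
        exact h
      exact ⟨almostEquivariant_of_map_add hl g hmono hp',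
        almostEquivariant_of_map_add hl _ (strictMono_inv g hmono) (inv_map_add g hp')⟩
  | one => exact ⟨AlmostEquivariant.id l, AlmostEquivariant.id l⟩
  | mul g h _ _ hg hh =>
    rw [mul_inv_rev]
    exact ⟨hg.1.comp hh.1, hh.2.comp hg.2⟩
  | inv g _ hg => exact ⟨hg.2, by simpa using hg.1⟩

/-- The integers that are close to `lℤ` are relatively dense in `ℤ`. -/
theorem exists_int_near_mul {l δ : ℝ} (hl : 0 < l) (hδ : 0 < δ) :
    ∃ M : ℕ, ∀ n : ℤ, ∃ m k : ℤ, |m - n| ≤ M ∧ |(m : ℝ) - k * l| < δ := by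
  obtain ⟨P, hP⟩ := exists_nat_gt (l / δ)
  have hP0 : (0 : ℝ) < P := (by positivity : 0 < l / δ).trans hP
  have hlP : l < P * δ := (div_lt_iff₀ hδ).1 hP
  -- `c n` is the index of the arc of length `l / P` of `ℝ / lℤ` that contains `n`
  let c : ℤ → ℤ := fun n => ⌊P * Int.fract ((n : ℝ) / l)⌋
  have hc : ∀ n, c n ∈ Finset.Ico (0 : ℤ) P := fun n => by
    rw [Finset.mem_Ico]
    refine ⟨Int.floor_nonneg.2 (mul_nonneg hP0.le (Int.fract_nonneg _)), Int.floor_lt.2 ?_⟩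
    have := Int.fract_lt_one ((n : ℝ) / l)
    push_cast
    nlinarith
  let r : ℤ → ℤ := Function.invFun c
  refine ⟨∑ i ∈ Finset.Ico (0 : ℤ) P, (r i).natAbs, fun n =>
    ⟨n - r (c n), ⌊(n : ℝ) / l⌋ - ⌊(r (c n) : ℝ) / l⌋, ?_, ?_⟩⟩
  · have h := Finset.single_le_sum (f := fun i => (r i).natAbs) (fun _ _ => Nat.zero_le _) (hc n)
    rw [Int.abs_eq_natAbs, sub_sub_cancel_left, Int.natAbs_neg]
    exact_mod_cast h
  · have hr : c (r (c n)) = c n := Function.invFun_eq ⟨n, rfl⟩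
    generalize r (c n) = j at hr ⊢
    have h := Int.abs_sub_lt_one_of_floor_eq_floor hr
    rw [← mul_sub, abs_mul, abs_of_pos hP0] at h
    have key : ((n - j : ℤ) : ℝ) - ((⌊(n : ℝ) / l⌋ - ⌊(j : ℝ) / l⌋ : ℤ) : ℝ) * l
        = l * -(Int.fract ((j : ℝ) / l) - Int.fract ((n : ℝ) / l)) := by
      rw [← Int.self_sub_floor, ← Int.self_sub_floor]
      push_cast
      field_simp
      ring
    rw [key, abs_mul, abs_neg, abs_of_pos hl]
    nlinarith [abs_nonneg (Int.fract ((j : ℝ) / l) - Int.fract ((n : ℝ) / l))]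

/-- Proposition 2.8 of the paper. Every `g ∈ G_λ` is repetitive: for
every `ε > 0` there is `N ∈ ℕ` such that every interval of length greater than `N`
contains an integer-translate `[m, m+1]` of `[0,1]` on which `g` is `ε`-close (in the
sup-metric, after translating back) to `g ↾ [0,1]`. -/
theorem stmt_9 (l : ℝ) (hl : 1 < l) (hirr : Irrational l)
    (g : Equiv.Perm ℝ) (hg : g ∈ Glambda l) :
    ∀ ε : ℝ, 0 < ε → ∃ N : ℕ, ∀ a b : ℝ, (N : ℝ) < b - a →
      ∃ m : ℤ, Set.Icc (m : ℝ) (m + 1) ⊆ Set.Ioo a b ∧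
        (⨆ x : ↥(Set.Icc (0 : ℝ) 1), |g (x : ℝ) - (g ((x : ℝ) + m) - m)|) < ε := by
  intro ε hε
  have hl0 : 0 < l := one_pos.trans hl
  obtain ⟨δ, hδ, H⟩ := (almostEquivariant_of_mem_Glambda hl0 hg).1 (ε / 2) (half_pos hε)
  obtain ⟨M, hM⟩ := exists_int_near_mul hl0 hδ
  refine ⟨2 * M + 4, fun a b hab => ?_⟩
  obtain ⟨m, k, hmn, hmk⟩ := hM ⌊(a + b) / 2⌋
  have h1 := Int.floor_le ((a + b) / 2)
  have h2 := Int.lt_floor_add_one ((a + b) / 2)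
  have h3 : |(m : ℝ) - ⌊(a + b) / 2⌋| ≤ M := by exact_mod_cast hmn
  rw [abs_le] at h3
  push_cast at hab
  refine ⟨m, fun x hx => ⟨by linarith [hx.1], by linarith [hx.2]⟩, ?_⟩
  have : Nonempty (Set.Icc (0 : ℝ) 1) := ⟨⟨0, by simp⟩⟩
  refine (ciSup_le fun x => ?_).trans_lt (half_lt_self hε)
  have h := H m k x (x + m) hmk (by simpa using hδ)
  rw [abs_sub_comm, sub_right_comm]
  exact h.le
end
end

section
/- Let n ≥ 3 and let (J₁,…,J_n, f₁,…,f_n) be a fast n-ring whose group G_n acts minimally on S¹. Then the derived subgroup H_n = [G_n, G_n] has the same orbits on S¹ as G_n; in particular, the action of H_n on S¹ is minimal (every H_n-orbit is dense in S¹). -/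
open Set

noncomputable section

/-- The circle `S¹ = ℝ/ℤ`. -/
abbrev S1 : Type := AddCircle (1 : ℝ)

/-- A bijection of `S¹` is an orientation-preserving homeomorphism if it admits a lift
to an increasing map `h : ℝ → ℝ` with `h (x + 1) = h x + 1`. -/
def CircleOP (f : Equiv.Perm S1) : Prop :=
  ∃ h : ℝ → ℝ, StrictMono h ∧ (∀ x : ℝ, h (x + 1) = h x + 1) ∧
    ∀ x : ℝ, ((h x : ℝ) : S1) = f (x : S1)

/-- `ringIter f i x l` is the point `x · f_i f_{i+1} ⋯ f_{i+l}` (right action: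
apply `f_i` first). -/
def ringIter {n : ℕ} (f : ZMod n → Equiv.Perm S1) (i : ZMod n) (x : S1) : ℕ → S1
  | 0 => f i x
  | l + 1 => f (i + (l : ZMod n) + 1) (ringIter f i x l)

/-- A fast `n`-ring of intervals and homeomorphisms on `S¹` (Definition 1.3 of the
paper), together with the dynamical condition `(*)`. The arcs `J i` are proper open
connected subsets covering `S¹`; consecutive arcs overlap in a proper nonempty
connected subarc and non-consecutive arcs are disjoint; `f i` is an
orientation-preserving homeomorphism with support exactly `J i`; `x i` is the endpoint
of `J (i+1)` lying in `J i`; and `(*)` holds. -/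
structure FastRing (n : ℕ) where
  J : ZMod n → Set S1
  f : ZMod n → Equiv.Perm S1
  x : ZMod n → S1
  isOpen' : ∀ i, IsOpen (J i)
  isConn : ∀ i, IsConnected (J i)
  proper : ∀ i, J i ≠ Set.univ
  covers : (⋃ i, J i) = Set.univ
  disj : ∀ i j : ZMod n, i ≠ j → i - j ≠ 1 → j - i ≠ 1 → J i ∩ J j = ∅
  adj_nonempty : ∀ i, (J i ∩ J (i + 1)).Nonempty
  adj_conn : ∀ i, IsConnected (J i ∩ J (i + 1))
  adj_ssub_left : ∀ i, J i ∩ J (i + 1) ⊂ J i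
  adj_ssub_right : ∀ i, J i ∩ J (i + 1) ⊂ J (i + 1)
  orient : ∀ i, CircleOP (f i)
  supp : ∀ i, {p : S1 | f i p ≠ p} = J i
  x_mem : ∀ i, x i ∈ J i
  x_endpoint : ∀ i, x i ∈ frontier (J (i + 1))
  fast : ∀ i : ZMod n, ∀ l : ℕ, 1 ≤ l → l ≤ n →
    ringIter f i (x i) l ∈ J (i + (l : ZMod n) + 1)

/-- The fast `n`-ring group `G_n = ⟨f₁, …, f_n⟩`. -/
def Gn {n : ℕ} (R : FastRing n) : Subgroup (Equiv.Perm S1) :=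
  Subgroup.closure (Set.range R.f)

/-- The derived subgroup `H_n = [G_n, G_n]`. -/
def Hn {n : ℕ} (R : FastRing n) : Subgroup (Equiv.Perm S1) := ⁅Gn R, Gn R⁆

/-- Minimality of the action of a group `G` of bijections of `S¹`: every orbit is
dense. -/
def MinimalAct (G : Subgroup (Equiv.Perm S1)) : Prop :=
  ∀ p : S1, Dense {q : S1 | ∃ g ∈ G, g p = q}

/-- If `A` is dense in the circle, `U` is an open proper subset and `A ∩ U` is connected,
then `U ⊆ A`. -/
theorem subset_of_dense_of_isPreconnected_inter {A U : Set S1} (hA : Dense A) (hU : IsOpen U)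
    (hne : U ≠ Set.univ) (hc : IsPreconnected (A ∩ U)) : U ⊆ A := by
  intro b hbU
  by_contra hbA
  obtain ⟨a, rfl⟩ := QuotientAddGroup.mk_surjective b
  change (a : S1) ∈ U at hbU
  change (a : S1) ∉ A at hbA
  have : Fact (0 < (1 : ℝ)) := ⟨one_pos⟩
  let e := AddCircle.openPartialHomeomorphCoe (1 : ℝ) a
  have hsub : A ∩ U ⊆ e.target := by
    rintro q ⟨hq, -⟩ rfl
    exact hbA hq
  have hK : (e.symm '' (A ∩ U)).OrdConnected :=
    (hc.image _ (e.continuousOn_symm.mono hsub)).ordConnected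
  have hcont : Continuous ((↑) : ℝ → S1) := AddCircle.continuous_mk' 1
  have hper (t : ℝ) : ((t + 1 : ℝ) : S1) = t := AddCircle.coe_add_period 1 t
  obtain ⟨ε, hε, hball⟩ := Metric.isOpen_iff.1 (hU.preimage hcont) a hbU
  have hnear {t : ℝ} (h₁ : a - ε < t) (h₂ : t < a + ε) : (t : S1) ∈ U :=
    hball (by rw [Metric.mem_ball, Real.dist_eq, abs_lt]; constructor <;> linarith)
  have hlift {t : ℝ} (ht : t ∈ Ioo a (a + 1)) (htA : (t : S1) ∈ A) (htU : (t : S1) ∈ U) :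
      t ∈ e.symm '' (A ∩ U) :=
    ⟨t, ⟨htA, htU⟩, e.left_inv ht⟩
  have hmeet {u v : ℝ} (huv : u < v) : ∃ t ∈ Ioo u v, (t : S1) ∈ A := by
    have hopen : IsOpen (((↑) : ℝ → S1) '' Ioo u v) :=
      QuotientAddGroup.isOpenMap_coe _ isOpen_Ioo
    obtain ⟨_, ⟨t, ht, rfl⟩, htA⟩ :=
      hA.inter_open_nonempty _ hopen ((nonempty_Ioo.2 huv).image _)
    exact ⟨t, ht, htA⟩
  refine hne (eq_univ_of_forall fun q => ?_)
  obtain ⟨s, hs, rfl⟩ : ∃ s ∈ Ico a (a + 1), (s : S1) = q := by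
    exact (AddCircle.coe_image_Ico_eq (1 : ℝ) a).ge (mem_univ q)
  rcases lt_or_ge s (a + ε) with h | h
  · exact hnear (by linarith [hs.1]) h
  rcases lt_or_ge (a + 1 - ε) s with h' | h'
  · have := hnear (t := s - 1) (by linarith) (by linarith [hs.2])
    rwa [← hper, sub_add_cancel] at this
  obtain ⟨t₁, ht₁, hA₁⟩ := hmeet (u := a) (v := a + ε) (by linarith)
  obtain ⟨t₂, ht₂, hA₂⟩ := hmeet (u := a + 1 - ε) (v := a + 1) (by linarith)
  have hU₂ : (t₂ : S1) ∈ U := by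
    have := hnear (t := t₂ - 1) (by linarith [ht₂.1]) (by linarith [ht₂.2])
    rwa [← hper, sub_add_cancel] at this
  have h₁ := hlift ⟨ht₁.1, by linarith [ht₁.2, hs.2]⟩ hA₁ (hnear (by linarith [ht₁.1]) ht₁.2)
  have h₂ := hlift ⟨by linarith [ht₂.1, hs.1], ht₂.2⟩ hA₂ hU₂
  obtain ⟨r, hr, hrs⟩ := hK.out h₁ h₂ ⟨by linarith [ht₁.2], by linarith [ht₂.1]⟩
  have : (s : S1) = r := by
    rw [← hrs]
    exact e.right_inv (hsub hr)
  exact this ▸ hr.2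

theorem FastRing.not_dense_J {n : ℕ} (R : FastRing n) (i : ZMod n) : ¬ Dense (R.J i) := by
  intro h
  have hsub := subset_of_dense_of_isPreconnected_inter h (R.isOpen' (i + 1)) (R.proper (i + 1))
    (R.adj_conn i).isPreconnected
  exact (R.adj_ssub_right i).not_subset (subset_inter hsub Subset.rfl)

open scoped commutatorElement in
/-- If the fixed-point set of `f ∈ G` meets the `G`-orbit of `f p`, then some commutator
of elements of `G` agrees with `f` at `p`. -/
theorem exists_mem_commutator_apply_eq {α : Type*} {G : Subgroup (Equiv.Perm α)}
    {f g : Equiv.Perm α} (hf : f ∈ G) (hg : g ∈ G) {p : α} (hfix : f (g (f p)) = g (f p)) :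
    ∃ h ∈ ⁅G, G⁆, h p = f p := by
  refine ⟨⁅g⁻¹, f⁻¹⁆, Subgroup.commutator_mem_commutator (inv_mem hg) (inv_mem hf), ?_⟩
  have hinv : f.symm (g (f p)) = g (f p) := f.symm_apply_eq.2 hfix.symm
  simp [commutatorElement_def, hinv]

theorem FastRing.exists_mem_Hn_apply_eq {n : ℕ} (R : FastRing n) (hmin : MinimalAct (Gn R))
    {g : Equiv.Perm S1} (hg : g ∈ Gn R) : ∀ p : S1, ∃ h ∈ Hn R, h p = g p := by
  induction hg using Subgroup.closure_induction with
  | mem f hf =>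
    obtain ⟨i, rfl⟩ := hf
    intro p
    have hne : (closure (R.J i))ᶜ.Nonempty :=
      nonempty_compl.2 fun h => R.not_dense_J i (dense_iff_closure_eq.2 h)
    obtain ⟨_, hq, g, hg, rfl⟩ :=
      (hmin (R.f i p)).inter_open_nonempty _ isClosed_closure.isOpen_compl hne
    refine exists_mem_commutator_apply_eq (Subgroup.subset_closure (mem_range_self i)) hg ?_
    by_contra hmoved
    exact hq (subset_closure (R.supp i ▸ hmoved))
  | one => exact fun p => ⟨1, one_mem _, rfl⟩
  | mul f g _ _ ihf ihg =>
    intro p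
    obtain ⟨k, hk, hkp⟩ := ihg p
    obtain ⟨h, hh, hhp⟩ := ihf (g p)
    exact ⟨h * k, mul_mem hh hk, by simp [hkp, hhp]⟩
  | inv g _ ih =>
    intro p
    obtain ⟨h, hh, hhp⟩ := ih (g⁻¹ p)
    exact ⟨h⁻¹, inv_mem hh, Equiv.Perm.inv_eq_iff_eq.2 (hhp.trans (g.apply_symm_apply p)).symm⟩

/-- For a fast `n`-ring (`n ≥ 3`) acting minimally on `S¹`, the
derived subgroup `H_n` has the same orbits on `S¹` as `G_n`; in particular the action
of `H_n` on `S¹` is minimal. -/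
theorem stmt_13 (n : ℕ) (hn : 3 ≤ n) (R : FastRing n) (hmin : MinimalAct (Gn R)) :
    (∀ p : S1, {q : S1 | ∃ g ∈ Hn R, g p = q} = {q : S1 | ∃ g ∈ Gn R, g p = q}) ∧
      MinimalAct (Hn R) := by
  have horb (p : S1) :
      {q : S1 | ∃ g ∈ Hn R, g p = q} = {q : S1 | ∃ g ∈ Gn R, g p = q} := by
    ext q
    constructor
    · rintro ⟨h, hh, rfl⟩
      exact ⟨h, Subgroup.commutator_le_self _ hh, rfl⟩
    · rintro ⟨g, hg, rfl⟩
      exact R.exists_mem_Hn_apply_eq hmin hg p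
  exact ⟨horb, fun p => (horb p).symm ▸ hmin p⟩
end
end

section
/- Let n ≥ 3 and let (J₁,…,J_n, f₁,…,f_n) be a fast n-ring whose group G_n acts minimally on S¹. Then the action of H_n = [G_n, G_n] on S¹ is proximal: for every arc I ⊆ S¹ whose complement has nonempty interior and every nonempty open set J ⊆ S¹, there exists h ∈ H_n with I·h ⊆ J. (In particular, the same property holds for the action of G_n.) -/
open Set

noncomputable section

/-- `h` lifts `g` along the projection `ℝ → S¹`. -/
def IsLift (h : ℝ ≃o ℝ) (g : Equiv.Perm S1) : Prop :=
  ∀ x : ℝ, ((h x : ℝ) : S1) = g (x : S1)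

/-- `G` can move the set `S` into every nonempty open set. -/
def Compressible (G : Subgroup (Equiv.Perm S1)) (S : Set S1) : Prop :=
  ∀ V : Set S1, IsOpen V → V.Nonempty → ∃ g ∈ G, ∀ x ∈ S, g x ∈ V

theorem IsLift.one : IsLift 1 1 := fun _ => rfl

theorem IsLift.mul {h k : ℝ ≃o ℝ} {f g : Equiv.Perm S1} (hf : IsLift h f) (hg : IsLift k g) :
    IsLift (h * k) (f * g) := fun x => by
  rw [RelIso.mul_apply, hf, hg, Equiv.Perm.mul_apply]

theorem IsLift.inv {h : ℝ ≃o ℝ} {f : Equiv.Perm S1} (hf : IsLift h f) :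
    IsLift h⁻¹ f⁻¹ := fun x => by
  rw [Equiv.Perm.eq_inv_iff_eq, ← hf, RelIso.apply_inv_self]

theorem IsLift.pow {h : ℝ ≃o ℝ} {f : Equiv.Perm S1} (hf : IsLift h f) (n : ℕ) :
    IsLift (h ^ n) (f ^ n) := by
  induction n with
  | zero => simpa using IsLift.one
  | succ k ih => rw [pow_succ, pow_succ]; exact ih.mul hf

theorem IsLift.zpow {h : ℝ ≃o ℝ} {f : Equiv.Perm S1} (hf : IsLift h f) (n : ℤ) :
    IsLift (h ^ n) (f ^ n) := by
  cases n with
  | ofNat n => simpa using hf.pow n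
  | negSucc n => rw [zpow_negSucc, zpow_negSucc]; exact (hf.pow _).inv

theorem IsLift.continuous {h : ℝ ≃o ℝ} {f : Equiv.Perm S1} (hf : IsLift h f) :
    Continuous f := by
  have hq : Topology.IsQuotientMap ((↑) : ℝ → S1) := isQuotientMap_quotient_mk'
  rw [hq.continuous_iff]
  have : (f ∘ ((↑) : ℝ → S1)) = fun x => ((h x : ℝ) : S1) := funext fun x => (hf x).symm
  rw [this]
  exact (AddCircle.continuous_mk' 1).comp h.continuous

theorem S1.coe_eq_coe_iff {x y : ℝ} : (x : S1) = y ↔ ∃ m : ℤ, x = y + m := by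
  rw [← sub_eq_zero, ← AddCircle.coe_sub, AddCircle.coe_eq_zero_iff]
  constructor
  · rintro ⟨m, hm⟩
    exact ⟨m, by simp at hm; linarith⟩
  · rintro ⟨m, hm⟩
    exact ⟨m, by simp; linarith⟩

theorem S1.coe_add_int (x : ℝ) (m : ℤ) : ((x + m : ℝ) : S1) = x :=
  S1.coe_eq_coe_iff.2 ⟨m, rfl⟩

theorem map_add_int_of_map_add_one {h : ℝ → ℝ} (h1 : ∀ x, h (x + 1) = h x + 1) (x : ℝ) (m : ℤ) :
    h (x + m) = h x + m := by
  induction m with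
  | zero => simp
  | succ k ih =>
    push_cast at ih ⊢
    rw [← add_assoc, h1, ih, add_assoc]
  | pred k ih =>
    push_cast at ih ⊢
    have := h1 (x + (-(k : ℝ) - 1))
    rw [show x + (-(k : ℝ) - 1) + 1 = x + -(k : ℝ) by ring, ih] at this
    linarith

theorem CircleOP.exists_isLift {f : Equiv.Perm S1} (hf : CircleOP f) :
    ∃ h : ℝ ≃o ℝ, IsLift h f ∧ ∀ x, h (x + 1) = h x + 1 := by
  obtain ⟨h, hm, h1, hl⟩ := hf
  have hs : Function.Surjective h := by
    intro y
    obtain ⟨z, hz⟩ := f.surjective (y : S1)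
    obtain ⟨x, rfl⟩ := QuotientAddGroup.mk_surjective z
    have h2 : ((h x : ℝ) : S1) = (y : S1) := (hl x).trans hz
    obtain ⟨m, hm'⟩ := S1.coe_eq_coe_iff.1 h2
    refine ⟨x + (-m : ℤ), ?_⟩
    rw [map_add_int_of_map_add_one h1, hm']
    push_cast
    ring
  exact ⟨hm.orderIsoOfSurjective h hs, hl, h1⟩

/-- A circle homeomorphism fixing the projections of the endpoints of `(a, b)`, where
`b ≤ a + 1`, has a lift fixing these endpoints. -/
theorem CircleOP.exists_isLift_fixing {f : Equiv.Perm S1} (hf : CircleOP f) {a b : ℝ}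
    (hab : a < b) (hb : b ≤ a + 1) (fa : f (a : S1) = a) (fb : f (b : S1) = b) :
    ∃ h : ℝ ≃o ℝ, IsLift h f ∧ h a = a ∧ h b = b := by
  obtain ⟨h, hl, h1⟩ := hf.exists_isLift
  obtain ⟨m, hm⟩ := S1.coe_eq_coe_iff.1 ((hl a).trans fa)
  obtain ⟨k, hk⟩ := S1.coe_eq_coe_iff.1 ((hl b).trans fb)
  have hlt : h a < h b := h.lt_iff_lt.2 hab
  have hle : h b ≤ h a + 1 := by rw [← h1]; exact h.le_iff_le.2 hb
  have hkm : k = m := by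
    have h2 : (k : ℝ) < m + 1 := by linarith
    have h3 : (m : ℝ) < k + 1 := by linarith
    have h2' : k < m + 1 := by exact_mod_cast h2
    have h3' : m < k + 1 := by exact_mod_cast h3
    omega
  subst hkm
  refine ⟨h.trans (OrderIso.addRight (-(k : ℝ))), fun x => ?_, ?_, ?_⟩
  · rw [← hl x]
    exact S1.coe_eq_coe_iff.2 ⟨-k, by simp⟩
  · simp [hm]
  · simp [hk]

/-- An order isomorphism of `ℝ` without fixed points in `(a, b)` drags points of `(a, b)`
arbitrarily close to `a`. -/
theorem OrderIso.exists_zpow_apply_lt {h : ℝ ≃o ℝ} {a b u v : ℝ}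
    (hne : ∀ x ∈ Ioo a b, h x ≠ x) (hu : a < u) (hv : v < b) :
    ∃ n : ℤ, (h ^ n) v < u := by
  by_contra! hcon
  have hbdd : BddBelow (range fun n : ℤ => (h ^ n) v) :=
    ⟨u, by rintro _ ⟨n, rfl⟩; exact hcon n⟩
  set s := sInf (range fun n : ℤ => (h ^ n) v) with hs
  have hle : ∀ n : ℤ, s ≤ (h ^ n) v := fun n => csInf_le hbdd ⟨n, rfl⟩
  have hus : u ≤ s := le_csInf (range_nonempty _) (by rintro _ ⟨n, rfl⟩; exact hcon n)
  have hsv : s ≤ v := by simpa using hle 0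
  refine hne s ⟨hu.trans_le hus, hsv.trans_lt hv⟩ (le_antisymm ?_ ?_)
  · refine le_csInf (range_nonempty _) ?_
    rintro _ ⟨n, rfl⟩
    have h2 := h.le_iff_le.2 (hle (n - 1))
    rwa [← RelIso.mul_apply, ← zpow_one_add, add_sub_cancel] at h2
  · have h3 : h⁻¹ s ≤ s := by
      refine le_csInf (range_nonempty _) ?_
      rintro _ ⟨n, rfl⟩
      have h2 := (h⁻¹).le_iff_le.2 (hle (1 + n))
      rwa [zpow_one_add, RelIso.mul_apply, RelIso.inv_apply_self] at h2
    simpa using h.le_iff_le.2 h3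

/-- A nonempty proper open connected subset of the circle is the projection of an open
interval of length at most `1`. -/
theorem S1.exists_eq_image_Ioo {J : Set S1} (ho : IsOpen J) (hc : IsConnected J)
    (hp : J ≠ univ) : ∃ a b : ℝ, a < b ∧ b ≤ a + 1 ∧ J = ((↑) : ℝ → S1) '' Ioo a b := by
  obtain ⟨z, hz⟩ := (ne_univ_iff_exists_notMem J).1 hp
  obtain ⟨p, rfl⟩ := QuotientAddGroup.mk_surjective z
  let e := AddCircle.openPartialHomeomorphCoe (1 : ℝ) p
  have hJe : J ⊆ e.target := fun x hx hxp => hz (by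
    have : x = (p : S1) := hxp
    exact this ▸ hx)
  set K := e.symm '' J with hK
  have hKc : IsConnected K := hc.image _ (e.continuousOn_symm.mono hJe)
  have hKo : IsOpen K := e.symm.isOpen_image_of_subset_source ho hJe
  have hKsub : K ⊆ Ioo p (p + 1) := by
    rintro _ ⟨x, hx, rfl⟩
    exact e.map_target (hJe hx)
  have hbb : BddBelow K := bddBelow_Ioo.mono hKsub
  have hba : BddAbove K := bddAbove_Ioo.mono hKsub
  have hKeq : K = Ioo (sInf K) (sSup K) := by
    refine Subset.antisymm ?_ (hKc.Ioo_csInf_csSup_subset hbb hba)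
    rw [← interior_Icc]
    exact interior_maximal (subset_Icc_csInf_csSup hbb hba) hKo
  refine ⟨sInf K, sSup K, ?_, ?_, ?_⟩
  · obtain ⟨x, hx⟩ := hKc.nonempty
    rw [hKeq] at hx
    exact hx.1.trans hx.2
  · have h1 : p ≤ sInf K := le_csInf hKc.nonempty fun x hx => (hKsub hx).1.le
    have h2 : sSup K ≤ p + 1 := csSup_le hKc.nonempty fun x hx => (hKsub hx).2.le
    linarith
  · rw [← hKeq, hK]
    exact (e.image_symm_image_of_subset_target hJe).symm

/-- The representing interval can be translated to contain a given lift of a point. -/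
theorem S1.exists_eq_image_Ioo_mem {J : Set S1} (ho : IsOpen J) (hc : IsConnected J)
    (hp : J ≠ univ) {s : ℝ} (hs : (s : S1) ∈ J) :
    ∃ a b : ℝ, s ∈ Ioo a b ∧ b ≤ a + 1 ∧ J = ((↑) : ℝ → S1) '' Ioo a b := by
  obtain ⟨a, b, hab, hb, rfl⟩ := S1.exists_eq_image_Ioo ho hc hp
  obtain ⟨t, ht, hts⟩ := hs
  obtain ⟨m, hm⟩ := S1.coe_eq_coe_iff.1 hts
  refine ⟨a - m, b - m, ⟨by linarith [ht.1], by linarith [ht.2]⟩, by linarith, ?_⟩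
  ext z
  constructor
  · rintro ⟨x, hx, rfl⟩
    exact ⟨x - m, ⟨by linarith [hx.1], by linarith [hx.2]⟩, S1.coe_eq_coe_iff.2 ⟨-m, by simp; ring⟩⟩
  · rintro ⟨x, hx, rfl⟩
    exact ⟨x + m, ⟨by linarith [hx.1], by linarith [hx.2]⟩, S1.coe_add_int x m⟩

theorem S1.coe_mem_image_Ioo {a b x : ℝ} (h1 : b - 1 ≤ x) (h2 : x ≤ a + 1) :
    (x : S1) ∈ ((↑) : ℝ → S1) '' Ioo a b ↔ x ∈ Ioo a b := by
  refine ⟨?_, fun h => ⟨x, h, rfl⟩⟩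
  rintro ⟨y, hy, hyx⟩
  obtain ⟨m, rfl⟩ := S1.coe_eq_coe_iff.1 hyx
  have h3 : (-1 : ℝ) < m := by linarith [hy.1]
  have h4 : (m : ℝ) < 1 := by linarith [hy.2]
  have h3' : -1 < m := by exact_mod_cast h3
  have h4' : m < 1 := by exact_mod_cast h4
  obtain rfl : m = 0 := by omega
  simpa using hy

theorem Compressible.mono {G : Subgroup (Equiv.Perm S1)} {S T : Set S1}
    (hT : Compressible G T) {g : Equiv.Perm S1} (hg : g ∈ G) (hST : ∀ x ∈ S, g x ∈ T) :
    Compressible G S := fun V hV hVn => by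
  obtain ⟨k, hk, hkV⟩ := hT V hV hVn
  exact ⟨k * g, mul_mem hk hg, fun x hx => hkV _ (hST x hx)⟩

namespace FastRing

variable {n : ℕ} (R : FastRing n)

theorem f_mem (i : ZMod n) : R.f i ∈ Gn R := Subgroup.subset_closure ⟨i, rfl⟩

theorem f_apply_eq {i : ZMod n} {x : S1} (hx : x ∉ R.J i) : R.f i x = x := by
  rw [← R.supp i] at hx
  simpa using hx

theorem exists_isLift {g : Equiv.Perm S1} (hg : g ∈ Gn R) : ∃ h : ℝ ≃o ℝ, IsLift h g := by
  induction hg using Subgroup.closure_induction with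
  | mem x hx =>
    obtain ⟨i, rfl⟩ := hx
    exact (R.orient i).exists_isLift.imp fun _ h => h.1
  | one => exact ⟨1, IsLift.one⟩
  | mul x y _ _ hx hy =>
    obtain ⟨h, hh⟩ := hx
    obtain ⟨k, hk⟩ := hy
    exact ⟨h * k, hh.mul hk⟩
  | inv x _ hx =>
    obtain ⟨h, hh⟩ := hx
    exact ⟨h⁻¹, hh.inv⟩

/-- Powers of `f i` drag points of `J i` arbitrarily close to its initial endpoint. -/
theorem exists_drag {i : ZMod n} {a b u v : ℝ} (hb : b ≤ a + 1)
    (hJ : R.J i = ((↑) : ℝ → S1) '' Ioo a b) (hu : u ∈ Ioo a b) (hv : v ∈ Ioo a b) :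
    ∃ g ∈ Gn R, ∃ h : ℝ ≃o ℝ, IsLift h g ∧ h a = a ∧ h v < u ∧ ∀ x ∉ R.J i, g x = x := by
  have ha' : (a : S1) ∉ R.J i := by
    rw [hJ, S1.coe_mem_image_Ioo (by linarith) (by linarith)]
    simp
  have hb' : (b : S1) ∉ R.J i := by
    rw [hJ, S1.coe_mem_image_Ioo (by linarith) (by linarith)]
    simp
  obtain ⟨h, hl, ha, -⟩ := (R.orient i).exists_isLift_fixing (hu.1.trans hu.2) hb
    (R.f_apply_eq ha') (R.f_apply_eq hb')
  have hne : ∀ x ∈ Ioo a b, h x ≠ x := by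
    intro x hx hfix
    have hxJ : (x : S1) ∈ R.J i := hJ ▸ ⟨x, hx, rfl⟩
    rw [← R.supp i] at hxJ
    exact hxJ (by rw [← hl, hfix])
  obtain ⟨m, hm⟩ := OrderIso.exists_zpow_apply_lt hne hu.1 hv.2
  refine ⟨R.f i ^ m, zpow_mem (R.f_mem i) m, h ^ m, hl.zpow m, ?_, hm, fun x hx => ?_⟩
  · have : h ∈ MulAction.stabilizer (ℝ ≃o ℝ) a := ha
    exact zpow_mem this m
  · exact Equiv.Perm.zpow_apply_eq_self_of_apply_eq_self (R.f_apply_eq hx) m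

theorem compressible_image_Icc (hmin : MinimalAct (Gn R)) {i : ZMod n} {a b u v : ℝ}
    (hb : b ≤ a + 1) (hJ : R.J i = ((↑) : ℝ → S1) '' Ioo a b) (hu : a < u)
    (hv : v ∈ Ioo a b) : Compressible (Gn R) (((↑) : ℝ → S1) '' Icc u v) := by
  intro V hV hVn
  obtain ⟨_, hq, g, hg, rfl⟩ := (hmin (a : S1)).inter_open_nonempty V hV hVn
  obtain ⟨k, hk⟩ := R.exists_isLift hg
  have hopen : IsOpen {x : ℝ | g (x : S1) ∈ V} :=
    (hV.preimage hk.continuous).preimage (AddCircle.continuous_mk' 1)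
  obtain ⟨ε, hε, hball⟩ := Metric.isOpen_iff.1 hopen a hq
  have hab : a < b := hv.1.trans hv.2
  obtain ⟨w, hw1, hw2⟩ := exists_between (lt_min hab (lt_add_of_pos_right a hε))
  obtain ⟨f, hf, h, hl, ha, hvw, -⟩ :=
    R.exists_drag hb hJ ⟨hw1, hw2.trans_le (min_le_left _ _)⟩ hv
  refine ⟨g * f, mul_mem hg hf, ?_⟩
  rintro _ ⟨x, hx, rfl⟩
  rw [Equiv.Perm.mul_apply, ← hl]
  apply hball
  have h1 : a < h x := by
    rw [← ha]
    exact h.lt_iff_lt.2 (hu.trans_le hx.1)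
  have h2 : h x ≤ h v := h.le_iff_le.2 hx.2
  have h3 := hw2.trans_le (min_le_right _ _)
  rw [Metric.mem_ball, Real.dist_eq, abs_lt]
  constructor <;> linarith

/-- Some arc `J i` contains a point lying in no other arc of a suitable subcover. -/
theorem exists_irredundant (hn : n ≠ 0) : ∃ T : Set (ZMod n), (⋃ j ∈ T, R.J j) = univ ∧
    ∃ i ∈ T, ∃ p ∈ R.J i, ∀ j ∈ T, j ≠ i → p ∉ R.J j := by
  have : NeZero n := ⟨hn⟩
  obtain ⟨T, hT⟩ := exists_minimal_of_wellFoundedLT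
    (fun T : Set (ZMod n) => (⋃ j ∈ T, R.J j) = univ) ⟨univ, by simpa using R.covers⟩
  have hne : T.Nonempty := by
    rw [nonempty_iff_ne_empty]
    rintro rfl
    have h := hT.prop
    simp only [mem_empty_iff_false, iUnion_of_empty, iUnion_empty] at h
    exact empty_ne_univ h
  obtain ⟨i, hi⟩ := hne
  refine ⟨T, hT.prop, i, hi, ?_⟩
  have hnot : (⋃ j ∈ T \ {i}, R.J j) ≠ univ := fun h =>
    (hT.le_of_le h sdiff_subset hi).2 rfl
  obtain ⟨p, hp⟩ := (ne_univ_iff_exists_notMem _).1 hnot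
  simp only [mem_iUnion, not_exists] at hp
  have hpT : p ∈ ⋃ j ∈ T, R.J j := hT.prop ▸ mem_univ p
  simp only [mem_iUnion] at hpT
  obtain ⟨j, hj, hpj⟩ := hpT
  by_cases hji : j = i
  · exact ⟨p, hji ▸ hpj, fun k hk hki => hp k ⟨hk, hki⟩⟩
  · exact absurd hpj (hp j ⟨hj, hji⟩)

/-- The complement of some compact subarc of some `J i` is compressible. -/
theorem exists_compressible_compl (hn : n ≠ 0) (hmin : MinimalAct (Gn R)) :
    ∃ (i : ZMod n) (a b u v : ℝ), R.J i = ((↑) : ℝ → S1) '' Ioo a b ∧ b ≤ a + 1 ∧ a < u ∧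
      v ∈ Ioo a b ∧ Compressible (Gn R) (((↑) : ℝ → S1) '' Icc u v)ᶜ := by
  obtain ⟨T, hT, i, hiT, z, hzi, hz⟩ := R.exists_irredundant hn
  obtain ⟨p, rfl⟩ := QuotientAddGroup.mk_surjective z
  obtain ⟨a, b, hp, hb, hJ⟩ :=
    S1.exists_eq_image_Ioo_mem (R.isOpen' i) (R.isConn i) (R.proper i) hzi
  set S : Set ℝ := {q | q ∈ Icc p (a + 1) ∧ Compressible (Gn R) (((↑) : ℝ → S1) '' Icc p q)}
    with hS
  have hpS : p ∈ S := ⟨⟨le_rfl, by linarith [hp.2]⟩, R.compressible_image_Icc hmin hb hJ hp.1 hp⟩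
  have hSb : BddAbove S := ⟨a + 1, fun q hq => hq.1.2⟩
  set s := sSup S with hs
  have hps : p ≤ s := le_csSup hSb hpS
  have hsa : s ≤ a + 1 := csSup_le ⟨p, hpS⟩ fun q hq => hq.1.2
  have key : ∃ d > s, ∀ q ∈ Ico s d, Compressible (Gn R) (((↑) : ℝ → S1) '' Icc p q) := by
    have hsT : (s : S1) ∈ ⋃ j ∈ T, R.J j := hT ▸ mem_univ _
    simp only [mem_iUnion] at hsT
    obtain ⟨j, hjT, hsj⟩ := hsT
    by_cases hji : j = i
    · subst hji
      rw [hJ, S1.coe_mem_image_Ioo (by linarith [hp.1]) hsa] at hsj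
      exact ⟨b, hsj.2, fun q hq => R.compressible_image_Icc hmin hb hJ hp.1
        ⟨hsj.1.trans_le hq.1, hq.2⟩⟩
    obtain ⟨c, d, hscd, hdc, hJj⟩ :=
      S1.exists_eq_image_Ioo_mem (R.isOpen' j) (R.isConn j) (R.proper j) hsj
    have hpj := hz j hjT hji
    have hpc : p ≤ c := by
      by_contra! hcon
      exact hpj (hJj ▸ ⟨p, ⟨hcon, hps.trans_lt hscd.2⟩, rfl⟩)
    have hdp : d ≤ p + 1 := by
      by_contra! hcon
      refine hpj (hJj ▸ ⟨p + 1, ⟨?_, hcon⟩, AddCircle.coe_add_period 1 p⟩)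
      linarith [hscd.1, hp.1]
    refine ⟨d, hscd.2, fun q hq => ?_⟩
    obtain ⟨r, hrS, hcr⟩ := exists_lt_of_lt_csSup ⟨p, hpS⟩ hscd.1
    have hrs : r ≤ s := le_csSup hSb hrS
    obtain ⟨g, hg, h, hl, hc, hqr, hfix⟩ := R.exists_drag hdc hJj
      (u := r) (v := q) ⟨hcr, hrs.trans_lt hscd.2⟩ ⟨hscd.1.trans_le hq.1, hq.2⟩
    refine hrS.2.mono hg ?_
    rintro _ ⟨x, hx, rfl⟩
    rcases le_or_gt x c with hxc | hxc
    · rw [hfix]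
      · exact ⟨x, ⟨hx.1, hxc.trans hcr.le⟩, rfl⟩
      · rw [hJj, S1.coe_mem_image_Ioo (by linarith [hx.1]) (by linarith)]
        exact fun h => h.1.not_ge hxc
    · rw [← hl]
      have h1 : h c < h x := h.lt_iff_lt.2 hxc
      have h2 : h x ≤ h q := h.le_iff_le.2 hx.2
      exact ⟨h x, ⟨by linarith, by linarith⟩, rfl⟩
  obtain ⟨d, hd, hcomp⟩ := key
  have hsa' : s = a + 1 := by
    by_contra hne
    obtain ⟨q, hsq, hq⟩ := exists_between (lt_min hd (lt_of_le_of_ne hsa hne))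
    refine (le_csSup hSb ⟨⟨hps.trans hsq.le, (hq.trans_le (min_le_right _ _)).le⟩,
      hcomp q ⟨hsq.le, hq.trans_le (min_le_left _ _)⟩⟩).not_gt hsq
  obtain ⟨q, hsq, hq⟩ := exists_between (lt_min hd (show s < p + 1 by linarith [hp.1]))
  have hq1 := hq.trans_le (min_le_left _ _)
  have hq2 := hq.trans_le (min_le_right _ _)
  refine ⟨i, a, b, q - 1, p, hJ, hb, by linarith, hp, ?_⟩
  refine (hcomp q ⟨hsq.le, hq1⟩).mono (one_mem _) fun z hz => ?_
  have hzu : z ∈ ((↑) : ℝ → S1) '' Icc (q - 1) (q - 1 + 1) := by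
    rw [AddCircle.coe_image_Icc_eq]
    trivial
  obtain ⟨x, hx, rfl⟩ := hzu
  refine ⟨x, ⟨?_, by linarith [hx.2]⟩, rfl⟩
  by_contra! hxp
  exact hz ⟨x, ⟨hx.1, hxp.le⟩, rfl⟩

theorem compressible_compl (hn : n ≠ 0) (hmin : MinimalAct (Gn R)) {U : Set S1}
    (hU : IsOpen U) (hUn : U.Nonempty) : Compressible (Gn R) Uᶜ := by
  obtain ⟨i, a, b, u, v, hJ, hb, hu, hv, hcomp⟩ := R.exists_compressible_compl hn hmin
  obtain ⟨g, hg, hgU⟩ := hcomp U hU hUn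
  refine (R.compressible_image_Icc hmin hb hJ hu hv).mono (inv_mem hg) fun x hx => ?_
  by_contra hcon
  have := hgU _ hcon
  rw [show g (g⁻¹ x) = x from g.apply_symm_apply x] at this
  exact hx this

theorem exists_isOpen_disjoint (i : ZMod n) :
    ∃ W : Set S1, IsOpen W ∧ W.Nonempty ∧ R.J i ⊆ Wᶜ := by
  obtain ⟨a, b, hab, hb, hJ⟩ := S1.exists_eq_image_Ioo (R.isOpen' i) (R.isConn i) (R.proper i)
  rcases hb.lt_or_eq with hlt | rfl
  · refine ⟨_, QuotientAddGroup.isOpenMap_coe _ (isOpen_Ioo (a := b) (b := a + 1)),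
      (nonempty_Ioo.2 hlt).image _, ?_⟩
    rintro z hz ⟨x, hx, rfl⟩
    have hz' : (x : S1) ∈ R.J i := hz
    rw [hJ, S1.coe_mem_image_Ioo (by linarith [hx.1]) hx.2.le] at hz'
    exact hz'.2.not_gt hx.1
  exfalso
  obtain ⟨z, hz1, hzi⟩ : ∃ z ∈ R.J (i + 1), z ∉ R.J i := by
    obtain ⟨z, hz, hz'⟩ := exists_of_ssubset (R.adj_ssub_right i)
    exact ⟨z, hz, fun h => hz' ⟨h, hz⟩⟩
  obtain ⟨t, rfl⟩ := QuotientAddGroup.mk_surjective z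
  obtain ⟨c, d, ht, hdc, hJ'⟩ :=
    S1.exists_eq_image_Ioo_mem (R.isOpen' (i + 1)) (R.isConn (i + 1)) (R.proper (i + 1)) hz1
  have hmem : ∀ x ∈ Ioo c d, x ≠ t → (x : S1) ∈ R.J i := by
    intro x hx hxt
    by_contra hxi
    have hfar : ∀ y : ℝ, (y : S1) ∉ R.J i → (y : S1) = a := by
      intro y hy
      have hyu : (y : S1) ∈ ((↑) : ℝ → S1) '' Ico a (a + 1) := by
        rw [AddCircle.coe_image_Ico_eq]
        trivial
      obtain ⟨w, hw, hwy⟩ := hyu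
      rcases hw.1.eq_or_lt with rfl | haw
      · exact hwy.symm
      · exact absurd (hJ ▸ ⟨w, ⟨haw, hw.2⟩, hwy⟩) hy
    obtain ⟨m, hm⟩ := S1.coe_eq_coe_iff.1 ((hfar x hxi).trans (hfar t hzi).symm)
    have h1 : (-1 : ℝ) < m := by linarith [hx.1, ht.2]
    have h2 : (m : ℝ) < 1 := by linarith [hx.2, ht.1]
    have h1' : -1 < m := by exact_mod_cast h1
    have h2' : m < 1 := by exact_mod_cast h2
    obtain rfl : m = 0 := by omega
    exact hxt (by simpa using hm)
  have hsub : R.J i ∩ R.J (i + 1) ⊆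
      ((↑) : ℝ → S1) '' Ioo c t ∪ ((↑) : ℝ → S1) '' Ioo t d := by
    rintro z ⟨hzJ, hzJ'⟩
    rw [hJ'] at hzJ'
    obtain ⟨x, hx, rfl⟩ := hzJ'
    rcases lt_trichotomy x t with hxt | rfl | hxt
    · exact Or.inl ⟨x, ⟨hx.1, hxt⟩, rfl⟩
    · exact absurd hzJ hzi
    · exact Or.inr ⟨x, ⟨hxt, hx.2⟩, rfl⟩
  obtain ⟨x, hx⟩ := nonempty_Ioo.2 ht.1
  obtain ⟨y, hy⟩ := nonempty_Ioo.2 ht.2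
  have hx' : x ∈ Ioo c d := ⟨hx.1, hx.2.trans ht.2⟩
  have hy' : y ∈ Ioo c d := ⟨ht.1.trans hy.1, hy.2⟩
  obtain ⟨z, -, ⟨x', hx1, rfl⟩, ⟨y', hy1, hyx⟩⟩ := (R.adj_conn i).isPreconnected _ _
    (QuotientAddGroup.isOpenMap_coe _ (isOpen_Ioo (a := c) (b := t)))
    (QuotientAddGroup.isOpenMap_coe _ (isOpen_Ioo (a := t) (b := d))) hsub
    ⟨x, ⟨hmem x hx' hx.2.ne, hJ' ▸ ⟨x, hx', rfl⟩⟩, ⟨x, hx, rfl⟩⟩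
    ⟨y, ⟨hmem y hy' hy.1.ne', hJ' ▸ ⟨y, hy', rfl⟩⟩, ⟨y, hy, rfl⟩⟩
  have hyx' : (y' : S1) ∈ ((↑) : ℝ → S1) '' Ioo c t := ⟨x', hx1, hyx.symm⟩
  rw [S1.coe_mem_image_Ioo (by linarith [hy1.1, ht.2]) (by linarith [hy1.2])] at hyx'
  linarith [hyx'.2, hy1.1]

open scoped commutatorElement in
/-- Every element of `G_n` is congruent modulo `H_n` to one supported in a prescribed nonempty
open set. -/
theorem exists_supported (hn : n ≠ 0) (hmin : MinimalAct (Gn R)) {W : Set S1} (hW : IsOpen W)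
    (hWn : W.Nonempty) {g : Equiv.Perm S1} (hg : g ∈ Gn R) :
    ∃ k ∈ Gn R, k⁻¹ * g ∈ Hn R ∧ ∀ x ∉ W, k x = x := by
  have hconj : ∀ k ∈ Gn R, ∀ m ∈ Hn R, k * m * k⁻¹ ∈ Hn R := by
    intro k hk m hm
    have h1 : ⁅k, m⁆ ∈ Hn R :=
      Subgroup.commutator_mem_commutator hk (Subgroup.commutator_le_self _ hm)
    simpa [commutatorElement_def] using mul_mem h1 hm
  induction hg using Subgroup.closure_induction with
  | mem x hx =>
    obtain ⟨i, rfl⟩ := hx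
    obtain ⟨U, hU, hUn, hJU⟩ := R.exists_isOpen_disjoint i
    obtain ⟨u, hu, huW⟩ := R.compressible_compl hn hmin hU hUn W hW hWn
    refine ⟨u * R.f i * u⁻¹, mul_mem (mul_mem hu (R.f_mem i)) (inv_mem hu), ?_, fun x hx => ?_⟩
    · have h1 : ⁅u, (R.f i)⁻¹⁆ ∈ Hn R :=
        Subgroup.commutator_mem_commutator hu (inv_mem (R.f_mem i))
      convert h1 using 1
      simp [commutatorElement_def, mul_assoc]
    · have h1 : u⁻¹ x ∉ R.J i := fun h => hx (by simpa using huW _ (hJU h))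
      rw [Equiv.Perm.mul_apply, Equiv.Perm.mul_apply, R.f_apply_eq h1]
      exact u.apply_symm_apply x
  | one => exact ⟨1, one_mem _, by simp [one_mem], fun _ _ => rfl⟩
  | mul x y hxG hyG hx hy =>
    obtain ⟨k, hk, hkx, hks⟩ := hx
    obtain ⟨l, hl, hly, hls⟩ := hy
    refine ⟨k * l, mul_mem hk hl, ?_, fun z hz => ?_⟩
    · have h1 := mul_mem (hconj _ (inv_mem hl) _ hkx) hly
      convert h1 using 1
      group
    · rw [Equiv.Perm.mul_apply, hls z hz, hks z hz]
  | inv x hxG hx =>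
    obtain ⟨k, hk, hkx, hks⟩ := hx
    refine ⟨k⁻¹, inv_mem hk, ?_, fun z hz => ?_⟩
    · have h1 := hconj _ hk _ (inv_mem hkx)
      convert h1 using 1
      group
    · rw [Equiv.Perm.inv_eq_iff_eq, hks z hz]

theorem exists_Hn_mapsTo (hn : n ≠ 0) (hmin : MinimalAct (Gn R)) {U V : Set S1}
    (hU : IsOpen U) (hUn : U.Nonempty) (hV : IsOpen V) (hVn : V.Nonempty) :
    ∃ h ∈ Hn R, ∀ x ∉ U, h x ∈ V := by
  obtain ⟨g, hg, hgV⟩ := R.compressible_compl hn hmin hU hUn V hV hVn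
  obtain ⟨k, -, hkg, hks⟩ := R.exists_supported hn hmin hV hVn hg
  refine ⟨k⁻¹ * g, hkg, fun x hx => ?_⟩
  by_contra hcon
  have h1 := hks _ hcon
  rw [Equiv.Perm.mul_apply, show k (k⁻¹ (g x)) = g x from k.apply_symm_apply _] at h1
  rw [Equiv.Perm.mul_apply, ← h1] at hcon
  exact hcon (hgV x hx)

end FastRing

/-- Lemma 3.4 of the paper. For a fast `n`-ring (`n ≥ 3`) acting
minimally on `S¹`, the action of `H_n` on `S¹` is proximal: every arc whose complement
has nonempty interior can be moved into any nonempty open set by an element of `H_n`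
(and in particular by an element of `G_n`). -/
theorem stmt_14 (n : ℕ) (hn : 3 ≤ n) (R : FastRing n) (hmin : MinimalAct (Gn R)) :
    (∀ I : Set S1, IsConnected I → (interior Iᶜ).Nonempty →
      ∀ V : Set S1, IsOpen V → V.Nonempty →
        ∃ h ∈ Hn R, (fun p : S1 => h p) '' I ⊆ V) ∧
    (∀ I : Set S1, IsConnected I → (interior Iᶜ).Nonempty →
      ∀ V : Set S1, IsOpen V → V.Nonempty →
        ∃ g ∈ Gn R, (fun p : S1 => g p) '' I ⊆ V) := by
  have key : ∀ I : Set S1, IsConnected I → (interior Iᶜ).Nonempty →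
      ∀ V : Set S1, IsOpen V → V.Nonempty →
        ∃ h ∈ Hn R, (fun p : S1 => h p) '' I ⊆ V := by
    intro I _ hI V hV hVn
    obtain ⟨h, hh, hhV⟩ := R.exists_Hn_mapsTo (by omega) hmin isOpen_interior hI hV hVn
    refine ⟨h, hh, ?_⟩
    rintro _ ⟨x, hx, rfl⟩
    exact hhV x fun hxI => interior_subset hxI hx
  refine ⟨key, fun I hI hIn V hV hVn => ?_⟩
  obtain ⟨h, hh, hhV⟩ := key I hI hIn V hV hVn
  exact ⟨h, Subgroup.commutator_le_self _ hh, hhV⟩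
end
end
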